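/- Let k ≥ 3 be an integer, r := (3^k + 1)/2, and set B := B_{3^k}(r+1) ∖ {(r, r−1), (r, 1^{r−1})}° ⊆ P(3^k) (explicitly, the removed set is {(r, r−1), (2^{r−1}, 1), (r, 1^{r−1})}). Then B ⋆ B = B_{2·3^k}(2r+2). -/

import Mathlib

open scoped Classical

namespace SylowBranching

/-- The cells of the Young diagram of `f` (rows indexed by the first coordinate,
starting from `0`; `f i` is the length of row `i`). -/
def cellsOf (f : ℕ → ℕ) : Set (ℕ × ℕ) := {p | p.2 < f p.1}

/-- `f : ℕ → ℕ` is a partition if it is weakly decreasing with finitely many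
nonzero parts.  Its parts are `f 0 ≥ f 1 ≥ ⋯`, and its largest part is `f 0`. -/
def IsPartition (f : ℕ → ℕ) : Prop :=
  Antitone f ∧ ∃ N, ∀ i, N ≤ i → f i = 0

/-- The size `|f|` of a partition: the number of cells of its Young diagram. -/
noncomputable def psize (f : ℕ → ℕ) : ℕ := (cellsOf f).ncard

/-- `P(n)`: the set of partitions of `n`. -/
def Pset (n : ℕ) : Set (ℕ → ℕ) := {f | IsPartition f ∧ psize f = n}

/-- The conjugate (transpose) partition `f'`. -/
noncomputable def conj (f : ℕ → ℕ) : ℕ → ℕ := fun j => Set.ncard {i | j < f i}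

/-- `A° = A ∪ A'`: the closure of a set of partitions under conjugation. -/
noncomputable def conjClosure (A : Set (ℕ → ℕ)) : Set (ℕ → ℕ) := A ∪ conj '' A

/-- `B_n(t)`: partitions of `n` with largest part at most `t` and at most `t` parts. -/
noncomputable def Bset (n t : ℕ) : Set (ℕ → ℕ) :=
  {f ∈ Pset n | f 0 ≤ t ∧ conj f 0 ≤ t}

/-- The cells of the skew shape `l / m`. -/
def skewCells (l m : ℕ → ℕ) : Set (ℕ × ℕ) :=
  {p | m p.1 ≤ p.2 ∧ p.2 < l p.1}

/-- `d` is read before (or at the same time as) `c` in the reading order of a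
filling: right-to-left along rows, rows from top to bottom. -/
def readBefore (d c : ℕ × ℕ) : Prop :=
  d.1 < c.1 ∨ (d.1 = c.1 ∧ c.2 ≤ d.2)

/-- A Littlewood–Richardson filling of the cell set `γ` of weight `ν`:
all entries are positive; for every `j ≥ 1` there are exactly `ν (j-1)` entries
equal to `j` (i.e. the number of `j`s is the `j`-th part of `ν`); entries weakly
increase along rows and strictly increase down columns; and every initial
segment of the reading word (right-to-left along rows, top to bottom) contains
at least as many entries equal to `j` as entries equal to `j+1`, for all `j ≥ 1`. -/
structure IsLRFilling (γ : Set (ℕ × ℕ)) (ν : ℕ → ℕ) (T : ℕ × ℕ → ℕ) : Prop where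
  pos : ∀ c ∈ γ, 1 ≤ T c
  weight : ∀ j : ℕ, 1 ≤ j → Set.ncard {c ∈ γ | T c = j} = ν (j - 1)
  row_weak : ∀ i j j', (i, j) ∈ γ → (i, j') ∈ γ → j ≤ j' → T (i, j) ≤ T (i, j')
  col_strict : ∀ i i' j, (i, j) ∈ γ → (i', j) ∈ γ → i < i' → T (i, j) < T (i', j)
  lattice : ∀ c ∈ γ, ∀ j : ℕ, 1 ≤ j →
    Set.ncard {d ∈ γ | T d = j + 1 ∧ readBefore d c} ≤
      Set.ncard {d ∈ γ | T d = j ∧ readBefore d c}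

/-- `LR(γ)`: the set of all weights of LR fillings of `γ`. -/
def LRset (γ : Set (ℕ × ℕ)) : Set (ℕ → ℕ) := {ν | ∃ T, IsLRFilling γ ν T}

/-- The Littlewood–Richardson coefficient `c^l_{m ν}`: the number of LR fillings
of the skew shape `l / m` of weight `ν` (zero unless `m ⊆ l`); fillings are
normalised to vanish off the skew shape so that they can be counted. -/
noncomputable def LRcoeff (l m ν : ℕ → ℕ) : ℕ :=
  Set.ncard {T : ℕ × ℕ → ℕ |
    (∀ i, m i ≤ l i) ∧ (∀ c, c ∉ skewCells l m → T c = 0) ∧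
      IsLRFilling (skewCells l m) ν T}

/-- The `⋆` operation on sets of partitions:
`A ⋆ B = {λ : c^λ_{μν} > 0 for some μ ∈ A, ν ∈ B}`. -/
def starOp (A B : Set (ℕ → ℕ)) : Set (ℕ → ℕ) :=
  {l | IsPartition l ∧ ∃ μ ∈ A, ∃ ν ∈ B, 0 < LRcoeff l μ ν}

/-- The partition with the given (weakly decreasing) list of parts. -/
def ofList (L : List ℕ) : ℕ → ℕ := fun i => L.getD i 0

/-- The hook partition `(a, 1^b)`. -/
def hookP (a b : ℕ) : ℕ → ℕ := ofList (a :: List.replicate b 1)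

/-- The partition `(a, μ)` obtained by prepending a first part `a` to `μ`. -/
def consPart (a : ℕ) (μ : ℕ → ℕ) : ℕ → ℕ := fun i => if i = 0 then a else μ (i - 1)

/-- `γ` coincides, up to planar translation, with the Young diagram of `ν`. -/
def TranslateOf (γ : Set (ℕ × ℕ)) (ν : ℕ → ℕ) : Prop :=
  ∃ a b : ℕ, γ = (fun p : ℕ × ℕ => (p.1 + a, p.2 + b)) '' cellsOf ν

/-- `γ` coincides, up to planar translation, with the 180°-rotation of the
Young diagram of `ν`. -/
def RotationOf (γ : Set (ℕ × ℕ)) (ν : ℕ → ℕ) : Prop :=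
  ∃ a b : ℕ, (∀ p ∈ cellsOf ν, p.1 ≤ a ∧ p.2 ≤ b) ∧
    γ = (fun p : ℕ × ℕ => (a - p.1, b - p.2)) '' cellsOf ν

/-- Iterated Littlewood–Richardson coefficients `c^l_{μ^1, …, μ^r}`:
`c^l_{μ} = δ_{l μ}`, and the coefficient for a longer list is obtained by
summing, over partitions `g` of the total size of the remaining factors, the
product of the iterated coefficient of `g` with `c^l_{g μ}`. -/
noncomputable def iterLR : List (ℕ → ℕ) → (ℕ → ℕ) → ℕ
  | [], l => if l = (fun _ => 0 : ℕ → ℕ) then 1 else 0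
  | [μ], l => if l = μ then 1 else 0
  | μ :: μs, l =>
      ∑' g : {g : ℕ → ℕ // IsPartition g ∧ psize g = (μs.map psize).sum},
        iterLR μs g.1 * LRcoeff l g.1 μ

/-- `D(q, m, B)`: partitions `λ` of `qm` with `c^λ_{μ_1, …, μ_q} > 0` for some
`μ_1, …, μ_q ∈ B` that are not all equal. -/
noncomputable def Dset (q m : ℕ) (B : Set (ℕ → ℕ)) : Set (ℕ → ℕ) :=
  {l ∈ Pset (q * m) | ∃ μ : Fin q → (ℕ → ℕ),
    (∀ i, μ i ∈ B) ∧ (∃ i j, μ i ≠ μ j) ∧ 0 < iterLR (List.ofFn μ) l}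

/-- Iterated `⋆` of a list of sets of partitions. -/
def starAll : List (Set (ℕ → ℕ)) → Set (ℕ → ℕ)
  | [] => Pset 0
  | [A] => A
  | A :: B :: rest => starOp A (starAll (B :: rest))

/-- `Ω(φ(1,0,…,0))` for the Sylow 3-subgroup of `S_{3^k}` (`k ≥ 4`):
`B_{3^k}(2a) ∖ {(2a, a−1, 1), (2a, 2, 1^{a−2}), (2a−1, a+1), (2a−1, 1^{a+1})}°`
where `a = 3^{k−1}`. -/
noncomputable def Cset (k : ℕ) : Set (ℕ → ℕ) :=
  Bset (3 ^ k) (2 * 3 ^ (k - 1)) \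
    conjClosure
      {ofList [2 * 3 ^ (k - 1), 3 ^ (k - 1) - 1, 1],
       ofList (2 * 3 ^ (k - 1) :: 2 :: List.replicate (3 ^ (k - 1) - 2) 1),
       ofList [2 * 3 ^ (k - 1) - 1, 3 ^ (k - 1) + 1],
       hookP (2 * 3 ^ (k - 1) - 1) (3 ^ (k - 1) + 1)}

/-! ### Partitions and conjugation -/

lemma finite_setOf_lt {f : ℕ → ℕ} (hf : ∃ N, ∀ i, N ≤ i → f i = 0) (j : ℕ) :
    {i | j < f i}.Finite := by
  obtain ⟨N, hN⟩ := hf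
  refine (Set.finite_lt_nat N).subset fun i hi => ?_
  by_contra h
  have := hN i (not_lt.mp h)
  simp only [Set.mem_ofPred_eq] at hi
  omega

lemma lt_conj_iff {f : ℕ → ℕ} (hf : IsPartition f) (i j : ℕ) : i < conj f j ↔ j < f i := by
  have hfin := finite_setOf_lt hf.2 j
  constructor
  · intro h
    by_contra hji
    have hsub : {k | j < f k} ⊆ Set.Iio i := by
      intro k hk
      by_contra hik
      have := hf.1 (not_lt.mp hik)
      simp only [Set.mem_ofPred_eq] at hk
      omega
    have := Set.ncard_le_ncard hsub (Set.finite_Iio i)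
    rw [Set.ncard_Iio_nat] at this
    simp only [conj] at h
    omega
  · intro h
    have hsub : Set.Iio (i + 1) ⊆ {k | j < f k} := by
      intro k hk
      have := hf.1 (Nat.lt_succ_iff.mp hk)
      simp only [Set.mem_ofPred_eq]
      omega
    have := Set.ncard_le_ncard hsub hfin
    rw [Set.ncard_Iio_nat] at this
    simp only [conj]
    omega

lemma isPartition_conj {f : ℕ → ℕ} (hf : ∃ N, ∀ i, N ≤ i → f i = 0) : IsPartition (conj f) := by
  refine ⟨fun a b hab => ?_, ?_⟩
  · exact Set.ncard_le_ncard (fun i hi => lt_of_le_of_lt hab hi) (finite_setOf_lt hf a)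
  · obtain ⟨N, hN⟩ := hf
    refine ⟨∑ i ∈ Finset.range N, f i, fun j hj => ?_⟩
    have : {i | j < f i} = ∅ := by
      ext i
      simp only [Set.mem_ofPred_eq, Set.mem_empty_iff_false, iff_false, not_lt]
      rcases lt_or_ge i N with h | h
      · exact (Finset.single_le_sum (f := f) (fun _ _ => Nat.zero_le _)
          (Finset.mem_range.mpr h)).trans hj
      · rw [hN i h]; exact Nat.zero_le _
    simp [conj, this]

lemma IsPartition.conj {f : ℕ → ℕ} (hf : IsPartition f) : IsPartition (conj f) :=
  isPartition_conj hf.2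

lemma conj_conj {f : ℕ → ℕ} (hf : IsPartition f) : conj (conj f) = f := by
  funext i
  refine eq_of_forall_lt_iff fun j => ?_
  rw [lt_conj_iff hf.conj, lt_conj_iff hf]

lemma cellsOf_finite {f : ℕ → ℕ} (hf : ∃ N, ∀ i, N ≤ i → f i = 0) : (cellsOf f).Finite := by
  obtain ⟨N, hN⟩ := hf
  have : cellsOf f ⊆ ⋃ i ∈ Set.Iio N, (fun j => (i, j)) '' Set.Iio (f i) := by
    rintro ⟨i, j⟩ h
    simp only [cellsOf, Set.mem_ofPred_eq] at h
    simp only [Set.mem_iUnion, Set.mem_image]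
    refine ⟨i, ?_, j, h, rfl⟩
    by_contra hi
    rw [hN i (not_lt.mp hi)] at h
    omega
  exact ((Set.finite_Iio N).biUnion fun i _ => (Set.finite_Iio (f i)).image _).subset this

lemma psize_eq_sum {f : ℕ → ℕ} {N : ℕ} (hN : ∀ i, N ≤ i → f i = 0) :
    psize f = ∑ i ∈ Finset.range N, f i := by
  have : cellsOf f = ↑(((Finset.range N).sigma fun i => Finset.range (f i)).image
      fun p => (p.1, p.2)) := by
    ext ⟨i, j⟩
    simp only [cellsOf, Set.mem_ofPred_eq]
    constructor
    · intro h
      have : i < N := by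
        by_contra hi
        rw [hN i (not_lt.mp hi)] at h
        omega
      simp [this, h]
    · intro h
      simp at h
      exact h.2
  rw [psize, this, Set.ncard_coe_finset, Finset.card_image_of_injective, Finset.card_sigma]
  · simp
  · rintro ⟨a, b⟩ ⟨c, d⟩ h
    simpa using h

lemma psize_conj {f : ℕ → ℕ} (hf : IsPartition f) : psize (conj f) = psize f := by
  have : cellsOf (conj f) = Prod.swap '' cellsOf f := by
    ext ⟨i, j⟩
    simp [cellsOf, lt_conj_iff hf]
  rw [psize, this, Set.ncard_image_of_injective _ Prod.swap_injective, psize]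

lemma conj_le_of_forall {f : ℕ → ℕ} {j m : ℕ} (h : ∀ i, m ≤ i → f i ≤ j) : conj f j ≤ m := by
  have hsub : {i | j < f i} ⊆ Set.Iio m := by
    intro i hi
    by_contra him
    have := h i (not_lt.mp him)
    simp only [Set.mem_ofPred_eq] at hi
    omega
  simpa [conj, Set.ncard_Iio_nat] using Set.ncard_le_ncard hsub (Set.finite_Iio m)

/-! ### Littlewood–Richardson fillings with an explicit matching -/

/-- A filling satisfying the conditions of a Littlewood–Richardson filling, with the lattice
condition witnessed by injections sending each entry `j + 1` to an entry `j` in a higher row. -/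
structure IsMatchedFilling (γ : Set (ℕ × ℕ)) (ν : ℕ → ℕ) (T : ℕ × ℕ → ℕ) : Prop where
  pos : ∀ c ∈ γ, 1 ≤ T c
  weight : ∀ j : ℕ, Set.ncard {c ∈ γ | T c = j + 1} = ν j
  row_weak : ∀ i j j', (i, j) ∈ γ → (i, j') ∈ γ → j ≤ j' → T (i, j) ≤ T (i, j')
  col_strict : ∀ i i' j, (i, j) ∈ γ → (i', j) ∈ γ → i < i' → T (i, j) < T (i', j)
  matching : ∀ j : ℕ, 1 ≤ j → ∃ φ : ℕ × ℕ → ℕ × ℕ, Set.InjOn φ {c ∈ γ | T c = j + 1} ∧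
    ∀ c ∈ γ, T c = j + 1 → φ c ∈ γ ∧ T (φ c) = j ∧ (φ c).1 < c.1

lemma IsMatchedFilling.isLRFilling {γ : Set (ℕ × ℕ)} {ν : ℕ → ℕ} {T : ℕ × ℕ → ℕ}
    (h : IsMatchedFilling γ ν T) (hγ : γ.Finite) : IsLRFilling γ ν T where
  pos := h.pos
  weight j hj := by
    have := h.weight (j - 1)
    rwa [Nat.sub_add_cancel hj] at this
  row_weak := h.row_weak
  col_strict := h.col_strict
  lattice c _ j hj := by
    obtain ⟨φ, hinj, hφ⟩ := h.matching j hj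
    refine Set.ncard_le_ncard_of_injOn φ ?_ (hinj.mono fun _ h => And.intro h.1 h.2.1)
      (hγ.subset fun _ h => h.1)
    rintro d ⟨hd, hT, hr⟩
    obtain ⟨h1, h2, h3⟩ := hφ d hd hT
    refine ⟨h1, h2, ?_⟩
    rcases hr with hr | hr
    · exact Or.inl (h3.trans hr)
    · exact Or.inl (hr.1 ▸ h3)

/-- The rank of a cell among the cells of `γ` carrying the same key, counted by rows. -/
noncomputable def keyRank (γ : Set (ℕ × ℕ)) (key : ℕ × ℕ → ℕ) (x : ℕ × ℕ) : ℕ :=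
  Set.ncard {y ∈ γ | key y = key x ∧ y.1 ≤ x.1}

section keyRank

variable {γ : Set (ℕ × ℕ)} {key : ℕ × ℕ → ℕ}

lemma keyRank_lt_keyRank (hγ : γ.Finite) {x y : ℕ × ℕ} (hy : y ∈ γ) (hxy : key x = key y)
    (hlt : x.1 < y.1) : keyRank γ key x < keyRank γ key y := by
  refine Set.ncard_lt_ncard ?_ (hγ.subset fun _ h => h.1)
  refine ⟨fun z hz => ⟨hz.1, hz.2.1.trans hxy, hz.2.2.trans hlt.le⟩, fun h => ?_⟩
  have := (h (show y ∈ _ from ⟨hy, rfl, le_rfl⟩)).2.2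
  omega

lemma eq_of_keyRank_eq (hγ : γ.Finite)
    (hkey : ∀ x ∈ γ, ∀ y ∈ γ, x.1 = y.1 → key x = key y → x = y) {x y : ℕ × ℕ} (hx : x ∈ γ)
    (hy : y ∈ γ) (hxy : key x = key y) (h : keyRank γ key x = keyRank γ key y) : x = y := by
  rcases lt_trichotomy x.1 y.1 with hlt | heq | hlt
  · exact absurd h (keyRank_lt_keyRank hγ hy hxy hlt).ne
  · exact hkey x hx y hy heq hxy
  · exact absurd h (keyRank_lt_keyRank hγ hx hxy.symm hlt).ne'

lemma one_le_keyRank (hγ : γ.Finite) {x : ℕ × ℕ} (hx : x ∈ γ) : 1 ≤ keyRank γ key x :=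
  (Set.ncard_pos (hγ.subset fun _ h => h.1)).mpr ⟨x, hx, rfl, le_rfl⟩

lemma keyRank_le (hγ : γ.Finite) (x : ℕ × ℕ) :
    keyRank γ key x ≤ Set.ncard {y ∈ γ | key y = key x} :=
  Set.ncard_le_ncard (fun _ hy => ⟨hy.1, hy.2.1⟩) (hγ.subset fun _ h => h.1)

lemma exists_keyRank_eq (hγ : γ.Finite)
    (hkey : ∀ x ∈ γ, ∀ y ∈ γ, x.1 = y.1 → key x = key y → x = y) {j k : ℕ}
    (hj : j < Set.ncard {y ∈ γ | key y = k}) : ∃ x ∈ γ, key x = k ∧ keyRank γ key x = j + 1 := by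
  have hfin : {y ∈ γ | key y = k}.Finite := hγ.subset fun _ h => h.1
  have himg : keyRank γ key '' {y ∈ γ | key y = k} =
      Set.Icc 1 (Set.ncard {y ∈ γ | key y = k}) := by
    refine Set.eq_of_subset_of_ncard_le ?_ ?_ (Set.finite_Icc _ _)
    · rintro _ ⟨x, hx, rfl⟩
      exact ⟨one_le_keyRank hγ hx.1, hx.2 ▸ keyRank_le hγ x⟩
    · rw [Set.InjOn.ncard_image]
      · simp [Set.ncard_eq_toFinset_card']
      · intro x hx y hy h
        exact eq_of_keyRank_eq hγ hkey hx.1 hy.1 (hx.2.trans hy.2.symm) h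
  have : j + 1 ∈ keyRank γ key '' {y ∈ γ | key y = k} := by
    rw [himg]; exact ⟨by omega, hj⟩
  obtain ⟨x, hx, h⟩ := this
  exact ⟨x, hx.1, hx.2, h⟩

lemma isMatchedFilling_keyRank (hγ : γ.Finite)
    (hkey : ∀ x ∈ γ, ∀ y ∈ γ, x.1 = y.1 → key x = key y → x = y)
    (hrow : ∀ i j j', (i, j) ∈ γ → (i, j') ∈ γ → j ≤ j' →
      keyRank γ key (i, j) ≤ keyRank γ key (i, j'))
    (hcol : ∀ i i' j, (i, j) ∈ γ → (i', j) ∈ γ → i < i' →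
      keyRank γ key (i, j) < keyRank γ key (i', j)) :
    IsMatchedFilling γ (conj fun k => Set.ncard {y ∈ γ | key y = k}) (keyRank γ key) where
  pos _ hc := one_le_keyRank hγ hc
  weight j := by
    have himg : key '' {c ∈ γ | keyRank γ key c = j + 1} =
        {k | j < Set.ncard {y ∈ γ | key y = k}} := by
      ext k
      constructor
      · rintro ⟨x, ⟨hx, hr⟩, rfl⟩
        have := keyRank_le (key := key) hγ x
        simp only [Set.mem_ofPred_eq]
        omega
      · intro hk
        obtain ⟨x, hx, hxk, hr⟩ := exists_keyRank_eq hγ hkey hk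
        exact ⟨x, ⟨hx, hr⟩, hxk⟩
    rw [conj, ← himg, Set.InjOn.ncard_image]
    intro x hx y hy h
    exact eq_of_keyRank_eq hγ hkey hx.1 hy.1 h (hx.2.trans hy.2.symm)
  row_weak := hrow
  col_strict := hcol
  matching j hj := by
    have hex : ∀ x : ℕ × ℕ, ∃ y, x ∈ γ → keyRank γ key x = j + 1 →
        y ∈ γ ∧ key y = key x ∧ keyRank γ key y = j := by
      intro x
      by_cases hx : x ∈ γ ∧ keyRank γ key x = j + 1
      · have hlt : j - 1 < Set.ncard {y ∈ γ | key y = key x} := by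
          have := keyRank_le (key := key) hγ x
          omega
        obtain ⟨y, hy, hk, hr⟩ := exists_keyRank_eq hγ hkey hlt
        exact ⟨y, fun _ _ => ⟨hy, hk, by omega⟩⟩
      · exact ⟨x, fun h1 h2 => absurd ⟨h1, h2⟩ hx⟩
    choose φ hφ using hex
    refine ⟨φ, ?_, ?_⟩
    · intro x hx y hy h
      have h1 := hφ x hx.1 hx.2
      have h2 := hφ y hy.1 hy.2
      refine eq_of_keyRank_eq hγ hkey hx.1 hy.1 ?_ (hx.2.trans hy.2.symm)
      rw [← h1.2.1, ← h2.2.1, h]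
    · intro x hx hr
      obtain ⟨h1, h2, h3⟩ := hφ x hx hr
      refine ⟨h1, h3, ?_⟩
      by_contra hle
      rcases (not_lt.mp hle).eq_or_lt with heq | hlt
      · have := hkey x hx _ h1 heq h2.symm
        rw [← this] at h3
        omega
      · have := keyRank_lt_keyRank hγ h1 h2.symm hlt
        omega

end keyRank

/-! ### Positivity of Littlewood–Richardson coefficients -/

/-- A matched filling of `l / m` of weight `ν` exists. -/
def LRPos (l m ν : ℕ → ℕ) : Prop :=
  (∀ i, m i ≤ l i) ∧ ∃ T, IsMatchedFilling (skewCells l m) ν T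

lemma skewCells_finite {l : ℕ → ℕ} (hl : IsPartition l) (m : ℕ → ℕ) : (skewCells l m).Finite :=
  (cellsOf_finite hl.2).subset fun _ h => h.2

/-- Right-justify the rows of `l / m` and number each resulting column from top to bottom. -/
lemma lrPos_rowFill {l m : ℕ → ℕ} (hl : IsPartition l) (hml : ∀ i, m i ≤ l i) :
    LRPos l m (conj (conj fun i => l i - m i)) := by
  refine ⟨hml, keyRank (skewCells l m) (fun x => l x.1 - 1 - x.2), ?_⟩
  set γ := skewCells l m with hγdef
  set key : ℕ × ℕ → ℕ := fun x => l x.1 - 1 - x.2 with hkeydef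
  have hγ : γ.Finite := skewCells_finite hl m
  have hfin : ∀ k, {i | k < l i - m i}.Finite :=
    finite_setOf_lt (hl.2.imp fun N hN i hi => by simp [hN i hi])
  have hmem : ∀ x : ℕ × ℕ, x ∈ γ ↔ m x.1 ≤ x.2 ∧ x.2 < l x.1 := fun _ => Iff.rfl
  have hkey : ∀ x ∈ γ, ∀ y ∈ γ, x.1 = y.1 → key x = key y → x = y := by
    rintro ⟨i, j⟩ hx ⟨i', j'⟩ hy h1 h2
    simp only [hmem, hkeydef] at *
    subst h1
    ext <;> simp; omega
  have hcount : ∀ k, Set.ncard {y ∈ γ | key y = k} = Set.ncard {i | k < l i - m i} := by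
    intro k
    have : {i | k < l i - m i} = Prod.fst '' {y ∈ γ | key y = k} := by
      ext i
      simp only [Set.mem_ofPred_eq, Set.mem_image, hmem, hkeydef]
      constructor
      · intro h
        exact ⟨(i, l i - 1 - k), by simp only; omega, rfl⟩
      · rintro ⟨⟨a, b⟩, h, rfl⟩
        simp only at *
        omega
    rw [this, Set.InjOn.ncard_image]
    intro x hx y hy h
    exact hkey x hx.1 y hy.1 h (hx.2.trans hy.2.symm)
  have hrank : ∀ x ∈ γ, keyRank γ key x = Set.ncard {i | key x < l i - m i ∧ i ≤ x.1} := by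
    intro x hx
    have : {i | key x < l i - m i ∧ i ≤ x.1} = Prod.fst '' {y ∈ γ | key y = key x ∧ y.1 ≤ x.1} := by
      ext i
      simp only [Set.mem_ofPred_eq, Set.mem_image, hmem]
      constructor
      · intro h
        refine ⟨(i, l i - 1 - key x), ?_, rfl⟩
        have h1 : key (i, l i - 1 - key x) = l i - 1 - (l i - 1 - key x) := rfl
        rw [h1]
        simp only
        omega
      · rintro ⟨⟨a, b⟩, ⟨h1, h2, h3⟩, rfl⟩
        rw [← h2]
        simp only [hkeydef] at *
        omega
    rw [this, Set.InjOn.ncard_image, keyRank]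
    intro y hy z hz h
    exact hkey y hy.1 z hz.1 h (hy.2.1.trans hz.2.1.symm)
  have hmain := isMatchedFilling_keyRank hγ hkey ?_ ?_
  · simp only [hcount] at hmain
    exact hmain
  · intro i j j' hj hj' hjj
    rw [hrank _ hj, hrank _ hj']
    refine Set.ncard_le_ncard (fun a ha => ⟨?_, ha.2⟩) ((hfin _).subset fun _ h => h.1)
    have := ha.1
    simp only [hkeydef] at *
    omega
  · intro i i' j hj hj' hii
    rw [hrank _ hj, hrank _ hj']
    have hle := hl.1 hii.le
    rw [hmem] at hj hj'
    refine Set.ncard_lt_ncard ⟨fun a ha => ⟨?_, ha.2.trans hii.le⟩, fun h => ?_⟩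
      ((hfin _).subset fun _ h => h.1)
    · have := ha.1
      simp only [hkeydef] at *
      omega
    · have hmem' : i' ∈ {a | key (i', j) < l a - m a ∧ a ≤ (i', j).1} := by
        refine ⟨?_, le_rfl⟩
        simp only [hkeydef] at *
        omega
      have := (h hmem').2
      simp only at this
      omega

/-- Number each column of `l / m` from top to bottom. -/
lemma lrPos_colFill {l m : ℕ → ℕ} (hl : IsPartition l) (hm : IsPartition m)
    (hml : ∀ i, m i ≤ l i) : LRPos l m (conj fun j => conj l j - conj m j) := by
  refine ⟨hml, keyRank (skewCells l m) Prod.snd, ?_⟩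
  have hγ := skewCells_finite hl m
  have hcount : ∀ k, Set.ncard {y ∈ skewCells l m | y.2 = k} = conj l k - conj m k := by
    intro k
    have : {y ∈ skewCells l m | y.2 = k} = (fun i => (i, k)) '' Set.Ico (conj m k) (conj l k) := by
      ext ⟨i, j⟩
      simp only [skewCells, Set.mem_ofPred_eq, Set.mem_image, Set.mem_Ico, Prod.mk.injEq]
      constructor
      · rintro ⟨⟨h1, h2⟩, rfl⟩
        refine ⟨i, ⟨?_, (lt_conj_iff hl _ _).mpr h2⟩, rfl, rfl⟩
        by_contra h
        rw [not_le, lt_conj_iff hm] at h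
        omega
      · rintro ⟨i, ⟨h1, h2⟩, rfl, rfl⟩
        refine ⟨⟨?_, (lt_conj_iff hl _ _).mp h2⟩, rfl⟩
        by_contra h
        rw [not_le, ← lt_conj_iff hm] at h
        omega
    rw [this, Set.ncard_image_of_injective _ (Prod.mk_left_injective k),
      Set.ncard_eq_toFinset_card']
    simp
  have hmain := isMatchedFilling_keyRank (key := Prod.snd) hγ
    (fun x _ y _ h1 h2 => Prod.ext h1 h2) ?_
    (fun i i' j _ hj' hii => keyRank_lt_keyRank hγ hj' rfl hii)
  · simp only [hcount] at hmain
    exact hmain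
  · intro i j j' hj hj' hjj
    refine Set.ncard_le_ncard_of_injOn (fun y => (y.1, j')) ?_ ?_ (hγ.subset fun _ h => h.1)
    · rintro ⟨a, b⟩ ⟨h1, h2, h3⟩
      simp only [skewCells, Set.mem_ofPred_eq] at *
      have := hl.1 h3
      exact ⟨⟨by omega, by omega⟩, by simp, h3⟩
    · rintro ⟨a, b⟩ ⟨_, h2, _⟩ ⟨a', b'⟩ ⟨_, h2', _⟩ h
      simp only [Prod.mk.injEq] at *
      exact ⟨h.1, h2.trans h2'.symm⟩

section consequences

variable {l m ν : ℕ → ℕ} {T : ℕ × ℕ → ℕ}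

lemma IsLRFilling.lt_conj_weight (h : IsLRFilling (skewCells l m) ν T) (hl : IsPartition l)
    (hν : IsPartition ν) {c : ℕ × ℕ} (hc : c ∈ skewCells l m) : T c ≤ conj ν 0 := by
  have hpos := h.pos c hc
  have h1 : 0 < Set.ncard {d ∈ skewCells l m | T d = T c} :=
    (Set.ncard_pos ((skewCells_finite hl m).subset fun _ h => h.1)).mpr ⟨c, hc, rfl⟩
  rw [h.weight _ hpos, ← lt_conj_iff hν] at h1
  omega

lemma psize_eq_add_ncard_skewCells (hl : IsPartition l) (hm : IsPartition m)
    (hml : ∀ i, m i ≤ l i) : psize l = psize m + (skewCells l m).ncard := by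
  have hunion : cellsOf l = cellsOf m ∪ skewCells l m := by
    ext x
    have := hml x.1
    simp only [cellsOf, skewCells, Set.mem_union, Set.mem_ofPred_eq]
    omega
  rw [psize, hunion, Set.ncard_union_eq ?_ (cellsOf_finite hm.2) (skewCells_finite hl m), psize]
  rw [Set.disjoint_left]
  intro x h1 h2
  simp only [cellsOf, skewCells, Set.mem_ofPred_eq] at h1 h2
  omega

lemma IsLRFilling.psize_eq (h : IsLRFilling (skewCells l m) ν T) (hl : IsPartition l)
    (hm : IsPartition m) (hν : IsPartition ν) (hml : ∀ i, m i ≤ l i) :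
    psize l = psize m + psize ν := by
  have hγ := skewCells_finite hl m
  rw [psize_eq_add_ncard_skewCells hl hm hml, psize_eq_sum (f := ν) (N := conj ν 0)]
  · rw [Set.ncard_eq_toFinset_card _ hγ, Finset.card_eq_sum_card_fiberwise (f := fun c => T c - 1)
      (t := Finset.range (conj ν 0))]
    · congr 1
      refine Finset.sum_congr rfl fun j _ => ?_
      have := h.weight (j + 1) (by omega)
      rw [Nat.add_sub_cancel] at this
      rw [← this, ← Set.ncard_coe_finset]
      congr 1
      ext c
      simp only [Finset.coe_filter, Set.Finite.mem_toFinset, Set.mem_ofPred_eq]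
      refine and_congr_right fun hc => ?_
      have := h.pos c hc
      omega
    · intro c hc
      have hc' : c ∈ skewCells l m := by simpa using hc
      have h1 := h.pos c hc'
      have h2 := h.lt_conj_weight hl hν hc'
      simp only [Finset.coe_range, Set.mem_Iio]
      omega
  · intro i hi
    by_contra h0
    have := (lt_conj_iff hν i 0).mpr (Nat.pos_of_ne_zero h0)
    omega

lemma IsLRFilling.apply_first_row (h : IsLRFilling (skewCells l m) ν T) (hl : IsPartition l)
    {c : ℕ} (hc : (0, c) ∈ skewCells l m) : T (0, c) = 1 := by
  have hγ := skewCells_finite hl m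
  by_contra hne
  have hpos := h.pos _ hc
  have hlat := h.lattice _ hc (T (0, c) - 1) (by omega)
  rw [Nat.sub_add_cancel hpos] at hlat
  have h1 : 0 < Set.ncard {d ∈ skewCells l m | T d = T (0, c) ∧ readBefore d (0, c)} :=
    (Set.ncard_pos (hγ.subset fun _ h => h.1)).mpr ⟨(0, c), hc, rfl, Or.inr ⟨rfl, le_rfl⟩⟩
  obtain ⟨⟨i, c'⟩, hd, hT, hr⟩ :=
    (Set.ncard_pos (hγ.subset fun _ h => h.1)).mp (h1.trans_le hlat)
  rcases hr with hr | ⟨hr, hcc⟩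
  · exact absurd hr (Nat.not_lt_zero _)
  · simp only at hr hcc
    subst hr
    have := h.row_weak 0 c c' hc hd hcc
    omega

lemma IsLRFilling.first_part_le (h : IsLRFilling (skewCells l m) ν T) (hl : IsPartition l) :
    l 0 ≤ m 0 + ν 0 := by
  have hsub : (fun c => (0, c)) '' Set.Ico (m 0) (l 0) ⊆ {c ∈ skewCells l m | T c = 1} := by
    rintro _ ⟨c, hc, rfl⟩
    exact ⟨hc, h.apply_first_row hl hc⟩
  have := Set.ncard_le_ncard hsub ((skewCells_finite hl m).subset fun _ h => h.1)
  rw [h.weight 1 le_rfl, Set.ncard_image_of_injective _ (Prod.mk_right_injective 0),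
    Set.ncard_eq_toFinset_card'] at this
  simp at this
  omega

lemma IsLRFilling.le_apply (h : IsLRFilling (skewCells l m) ν T) (hl : IsPartition l) {a : ℕ}
    (hm : ∀ i, a ≤ i → m i = 0) (k x : ℕ) (hk : x < l (a + k)) : k + 1 ≤ T (a + k, x) := by
  have hmem : ∀ k, x < l (a + k) → (a + k, x) ∈ skewCells l m := by
    intro k hk
    refine ⟨?_, hk⟩
    simp [hm (a + k) (by omega)]
  induction k with
  | zero => exact h.pos _ (hmem 0 hk)
  | succ k ih =>
    have hk' : x < l (a + k) := hk.trans_le (hl.1 (by omega))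
    have := h.col_strict _ _ x (hmem k hk') (hmem (k + 1) hk) (by omega)
    have := ih hk'
    omega

lemma IsLRFilling.length_le (h : IsLRFilling (skewCells l m) ν T) (hl : IsPartition l)
    (hm : IsPartition m) (hν : IsPartition ν) : conj l 0 ≤ conj m 0 + conj ν 0 := by
  by_contra hlt
  have hzero : ∀ i, conj m 0 ≤ i → m i = 0 := by
    intro i hi
    by_contra h0
    have := (lt_conj_iff hm i 0).mpr (Nat.pos_of_ne_zero h0)
    omega
  have hpos : 0 < l (conj m 0 + conj ν 0) := (lt_conj_iff hl _ _).mp (by omega)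
  have h1 := h.le_apply hl hzero _ 0 hpos
  have h2 := h.lt_conj_weight hl hν (c := (conj m 0 + conj ν 0, 0))
    ⟨by simp [hzero _ (Nat.le_add_right _ _)], hpos⟩
  omega

end consequences

lemma exists_isLRFilling_of_lrCoeff_pos {l m ν : ℕ → ℕ} (h : 0 < LRcoeff l m ν) :
    (∀ i, m i ≤ l i) ∧ ∃ T, IsLRFilling (skewCells l m) ν T := by
  obtain ⟨T, h1, _, h3⟩ := Set.nonempty_of_ncard_ne_zero h.ne'
  exact ⟨h1, T, h3⟩

lemma LRPos.lrCoeff_pos {l m ν : ℕ → ℕ} (h : LRPos l m ν) (hl : IsPartition l)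
    (hν : IsPartition ν) : 0 < LRcoeff l m ν := by
  obtain ⟨hml, T, hT⟩ := h
  have hγ := skewCells_finite hl m
  have hT := hT.isLRFilling hγ
  unfold LRcoeff
  refine (Set.ncard_pos ?_).mpr ?_
  rotate_left
  · refine ⟨fun c => if c ∈ skewCells l m then T c else 0, hml, fun c hc => by simp [hc], ?_⟩
    have hset : ∀ P : ℕ → ℕ × ℕ → Prop, {c ∈ skewCells l m |
        P (if c ∈ skewCells l m then T c else 0) c} = {c ∈ skewCells l m | P (T c) c} := by
      intro P
      ext c
      simp only [Set.mem_ofPred_eq]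
      refine and_congr_right fun hc => by rw [if_pos hc]
    refine ⟨?_, ?_, ?_, ?_, ?_⟩
    · intro c hc
      simpa [hc] using hT.pos c hc
    · intro j hj
      rw [hset fun v _ => v = j]
      exact hT.weight j hj
    · intro i j j' h1 h2 hj
      simpa [h1, h2] using hT.row_weak i j j' h1 h2 hj
    · intro i i' j h1 h2 hi
      simpa [h1, h2] using hT.col_strict i i' j h1 h2 hi
    · intro c hc j hj
      rw [hset fun v d => v = j + 1 ∧ readBefore d c, hset fun v d => v = j ∧ readBefore d c]
      exact hT.lattice c hc j hj
  · have := hγ.to_subtype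
    have hfin : (Set.pi Set.univ fun _ : skewCells l m => Set.Iic (conj ν 0)).Finite :=
      Set.Finite.pi fun _ => Set.finite_Iic _
    refine Set.Finite.of_finite_image (f := fun S (c : skewCells l m) => S c.1)
      (hfin.subset ?_) ?_
    · rintro _ ⟨S, ⟨_, _, hS⟩, rfl⟩ c _
      exact hS.lt_conj_weight hl hν c.2
    · rintro S ⟨_, hS, _⟩ S' ⟨_, hS', _⟩ heq
      funext c
      by_cases hc : c ∈ skewCells l m
      · exact congrFun heq ⟨c, hc⟩
      · rw [hS c hc, hS' c hc]

/-! ### Adding a first row and a first column -/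

@[simp] lemma consPart_zero (a : ℕ) (f : ℕ → ℕ) : consPart a f 0 = a := rfl

@[simp] lemma consPart_succ (a : ℕ) (f : ℕ → ℕ) (i : ℕ) : consPart a f (i + 1) = f i := rfl

/-- A first row can be added to a filling: fill the new row by `1` and raise all other entries. -/
lemma LRPos.consPart {l m ν : ℕ → ℕ} (h : LRPos l m ν) (hl : IsPartition l) {a b : ℕ}
    (hb : ν 0 ≤ b) :
    LRPos (consPart (a + b) l) (consPart a m) (consPart b ν) := by
  obtain ⟨hml, T, hT⟩ := h
  have hγ := skewCells_finite hl m
  set γ := skewCells l m with hγdef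
  set γ' := skewCells (SylowBranching.consPart (a + b) l) (SylowBranching.consPart a m)
    with hγ'def
  have hzero : ∀ x, (0, x) ∈ γ' ↔ x ∈ Set.Ico a (a + b) := fun _ => Iff.rfl
  have hsucc : ∀ i x, (i + 1, x) ∈ γ' ↔ (i, x) ∈ γ := fun _ _ => Iff.rfl
  set T' : ℕ × ℕ → ℕ := fun c => if c.1 = 0 then 1 else T (c.1 - 1, c.2) + 1 with hT'def
  have hT0 : ∀ x, T' (0, x) = 1 := fun _ => rfl
  have hTs : ∀ i x, T' (i + 1, x) = T (i, x) + 1 := fun _ _ => rfl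
  have hone : {c ∈ γ' | T' c = 1} = (fun x => (0, x)) '' Set.Ico a (a + b) := by
    ext ⟨i, x⟩
    simp only [Set.mem_ofPred_eq, Set.mem_image]
    constructor
    · rintro ⟨h1, h2⟩
      rcases i with _ | i
      · exact ⟨x, (hzero x).mp h1, rfl⟩
      · have := hT.pos _ ((hsucc i x).mp h1)
        rw [hTs] at h2
        omega
    · rintro ⟨y, hy, heq⟩
      simp only [Prod.mk.injEq] at heq
      obtain ⟨rfl, rfl⟩ := heq
      exact ⟨(hzero y).mpr hy, hT0 y⟩
  have hcard : Set.ncard {c ∈ γ' | T' c = 1} = b := by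
    rw [hone, Set.ncard_image_of_injective _ (Prod.mk_right_injective 0),
      Set.ncard_eq_toFinset_card']
    simp
  have hshift : ∀ j, 1 ≤ j →
      {c ∈ γ' | T' c = j + 1} = (fun c : ℕ × ℕ => (c.1 + 1, c.2)) '' {c ∈ γ | T c = j} := by
    intro j hj
    ext ⟨i, x⟩
    simp only [Set.mem_ofPred_eq, Set.mem_image]
    constructor
    · rintro ⟨h1, h2⟩
      rcases i with _ | i
      · rw [hT0] at h2
        omega
      · exact ⟨(i, x), ⟨(hsucc i x).mp h1, by rw [hTs] at h2; omega⟩, rfl⟩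
    · rintro ⟨⟨i', y⟩, ⟨h1, h2⟩, heq⟩
      simp only [Prod.mk.injEq] at heq
      obtain ⟨rfl, rfl⟩ := heq
      exact ⟨(hsucc _ _).mpr h1, by rw [hTs, h2]⟩
  have hinj : Function.Injective (fun c : ℕ × ℕ => (c.1 + 1, c.2)) := by
    rintro ⟨i, x⟩ ⟨i', x'⟩ h
    simpa using h
  refine ⟨fun i => ?_, T', ?_, ?_, ?_, ?_, ?_⟩
  · rcases i with _ | i
    · simp
    · simpa using hml i
  · rintro ⟨_ | i, x⟩ _
    · exact le_rfl
    · rw [hTs]; omega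
  · rintro (_ | j)
    · exact hcard
    · rw [hshift _ (by omega), Set.ncard_image_of_injective _ hinj, hT.weight]
      rfl
  · rintro (_ | i) j j' h1 h2 hj
    · exact le_rfl
    · have := hT.row_weak i j j' h1 h2 hj
      rw [hTs, hTs]
      omega
  · rintro (_ | i) (_ | i') j h1 h2 hi
    · omega
    · have := hT.pos _ ((hsucc i' j).mp h2)
      rw [hT0, hTs]
      omega
    · omega
    · have := hT.col_strict i i' j h1 h2 (by omega)
      rw [hTs, hTs]
      omega
  · intro j hj
    rcases hj.eq_or_lt with rfl | hj
    · have hfin : {c ∈ γ' | T' c = 1 + 1}.Finite := by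
        rw [hshift 1 le_rfl]
        exact (hγ.subset fun _ h => h.1).image _
      have hfin1 : {c ∈ γ' | T' c = 1}.Finite := by
        rw [hone]
        exact (Set.finite_Ico _ _).image _
      have hle : {c ∈ γ' | T' c = 1 + 1}.encard ≤ {c ∈ γ' | T' c = 1}.encard := by
        rw [← hfin.cast_ncard_eq, ← hfin1.cast_ncard_eq, hcard, hshift 1 le_rfl,
          Set.ncard_image_of_injective _ hinj, ← zero_add 1, hT.weight]
        exact_mod_cast hb
      obtain ⟨φ, hsub, hφ⟩ := hfin.exists_injOn_of_encard_le hle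
      refine ⟨φ, hφ, fun c hc hc2 => ?_⟩
      have hmem := hsub (show c ∈ _ from ⟨hc, hc2⟩)
      refine ⟨hmem.1, hmem.2, ?_⟩
      rw [hone] at hmem
      obtain ⟨x, _, hx⟩ := hmem
      rw [← hx]
      by_contra h0
      obtain ⟨i, y⟩ := c
      have : i = 0 := by simp only at h0; omega
      subst this
      rw [hT0] at hc2
      omega
    · obtain ⟨φ, hφ, hφ'⟩ := hT.matching (j - 1) (by omega)
      rw [Nat.sub_add_cancel (by omega)] at hφ hφ'
      refine ⟨fun c => ((φ (c.1 - 1, c.2)).1 + 1, (φ (c.1 - 1, c.2)).2), ?_, ?_⟩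
      · rw [hshift j (by omega)]
        rintro _ ⟨c, hc, rfl⟩ _ ⟨d, hd, rfl⟩ heq
        have := hφ hc hd (hinj heq)
        rw [this]
      · rintro c hc hc2
        have hmem : c ∈ {c ∈ γ' | T' c = j + 1} := ⟨hc, hc2⟩
        rw [hshift j (by omega)] at hmem
        obtain ⟨d, hd, rfl⟩ := hmem
        obtain ⟨h1, h2, h3⟩ := hφ' d hd.1 hd.2
        refine ⟨(hsucc _ _).mpr h1, ?_, ?_⟩
        · simp only [Nat.add_sub_cancel]
          rw [hTs]
          simp only [Prod.mk.eta, h2]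
          omega
        · simpa using h3

/-- Prepend a first column of length `a` to a partition with at most `a` parts. -/
def addCol (a : ℕ) (f : ℕ → ℕ) : ℕ → ℕ := fun i => (if i < a then 1 else 0) + f i

/-- A first column can be added to a filling: number the cells of the new column. -/
lemma LRPos.addCol {l m ν : ℕ → ℕ} (h : LRPos l m ν) (hl : IsPartition l) {a b : ℕ}
    (ha : ∀ i, a ≤ i → m i = 0) (hab : ∀ i, a + b ≤ i → l i = 0) :
    LRPos (addCol (a + b) l) (addCol a m) (addCol b ν) := by
  obtain ⟨hml, T, hT⟩ := h
  have hγ := skewCells_finite hl m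
  have hle := (hT.isLRFilling hγ).le_apply hl ha
  set γ := skewCells l m with hγdef
  set γ' := skewCells (SylowBranching.addCol (a + b) l) (SylowBranching.addCol a m)
    with hγ'def
  have hmem' : ∀ i x, (i, x) ∈ γ' ↔ (if i < a then 1 else 0) + m i ≤ x ∧
    x < (if i < a + b then 1 else 0) + l i := fun _ _ => Iff.rfl
  have hmem : ∀ i x, (i, x) ∈ γ ↔ m i ≤ x ∧ x < l i := fun _ _ => Iff.rfl
  have hzero : ∀ i, (i, 0) ∈ γ' ↔ a ≤ i ∧ i < a + b := by
    intro i
    rw [hmem']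
    have := ha i
    have := hab i
    split_ifs <;> omega
  have hsucc : ∀ i x, (i, x + 1) ∈ γ' ↔ (i, x) ∈ γ := by
    intro i x
    rw [hmem', hmem]
    have := ha i
    have := hab i
    split_ifs <;> omega
  set T' : ℕ × ℕ → ℕ := fun c => if c.2 = 0 then c.1 - a + 1 else T (c.1, c.2 - 1) with hT'def
  have hT0 : ∀ i, T' (i, 0) = i - a + 1 := fun _ => rfl
  have hTs : ∀ i x, T' (i, x + 1) = T (i, x) := fun _ _ => rfl
  have hinj : Function.Injective (fun c : ℕ × ℕ => (c.1, c.2 + 1)) := by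
    rintro ⟨i, x⟩ ⟨i', x'⟩ h
    simpa using h
  have hset : ∀ j, {c ∈ γ' | T' c = j + 1} = (if j < b then {(a + j, 0)} else ∅) ∪
      (fun c : ℕ × ℕ => (c.1, c.2 + 1)) '' {c ∈ γ | T c = j + 1} := by
    intro j
    ext ⟨i, x⟩
    simp only [Set.mem_ofPred_eq, Set.mem_union, Set.mem_image]
    rcases x with _ | x
    · rw [hzero, hT0]
      split_ifs <;> simp <;> omega
    · rw [hsucc, hTs]
      split_ifs <;> simp
  refine ⟨fun i => ?_, T', ?_, ?_, ?_, ?_, ?_⟩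
  · have := hml i
    simp only [SylowBranching.addCol]
    split_ifs <;> omega
  · rintro ⟨i, _ | x⟩ hc
    · rw [hT0]; omega
    · rw [hTs]
      exact hT.pos _ ((hsucc i x).mp hc)
  · intro j
    rw [hset, Set.ncard_union_eq ?_ ?_ ?_, Set.ncard_image_of_injective _ hinj, hT.weight]
    · simp only [SylowBranching.addCol]
      split_ifs <;> simp
    · rw [Set.disjoint_left]
      rintro _ h1 ⟨c, _, rfl⟩
      split_ifs at h1 <;> simp at h1
    · split_ifs <;> simp
    · exact (hγ.subset fun _ h => h.1).image _
  · rintro i (_ | j) (_ | j') h1 h2 hj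
    · exact le_rfl
    · rw [hT0, hTs]
      rw [hzero] at h1
      rw [hsucc] at h2
      have h3 := hle (i - a) j'
      rw [Nat.add_sub_cancel' h1.1] at h3
      exact h3 h2.2
    · omega
    · rw [hsucc] at h1 h2
      exact hT.row_weak i j j' h1 h2 (by omega)
  · rintro i i' (_ | j) h1 h2 hi
    · rw [hzero] at h1 h2
      rw [hT0, hT0]
      omega
    · rw [hsucc] at h1 h2
      exact hT.col_strict i i' j h1 h2 hi
  · intro j hj
    obtain ⟨φ, hφ, hφ'⟩ := hT.matching j hj
    refine ⟨fun c => if c.2 = 0 then (c.1 - 1, 0) else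
      ((φ (c.1, c.2 - 1)).1, (φ (c.1, c.2 - 1)).2 + 1), ?_, ?_⟩
    · rintro ⟨i, _ | x⟩ hc ⟨i', _ | x'⟩ hd heq
      · have h1 := hc.2
        have h2 := hd.2
        rw [hT0] at h1 h2
        have : i = i' := by omega
        rw [this]
      · simp at heq
      · simp at heq
      · have := hφ (x₁ := (i, x)) ⟨(hsucc _ _).mp hc.1, hc.2⟩ (x₂ := (i', x'))
          ⟨(hsucc _ _).mp hd.1, hd.2⟩ (by simpa [Prod.ext_iff] using heq)
        simpa using this
    · rintro ⟨i, _ | x⟩ hc hc2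
      · rw [hzero] at hc
        rw [hT0] at hc2
        simp only [if_true]
        rw [hzero, hT0]
        omega
      · obtain ⟨h1, h2, h3⟩ := hφ' (i, x) ((hsucc _ _).mp hc) hc2
        simp only [Nat.add_eq_zero_iff, one_ne_zero, and_false, if_false, Nat.add_sub_cancel]
        exact ⟨(hsucc _ _).mpr h1, h2, h3⟩

/-! ### Sizes and shapes of partitions -/

lemma IsPartition.le_of_conj_le {f : ℕ → ℕ} (hf : IsPartition f) {i j : ℕ}
    (h : SylowBranching.conj f j ≤ i) : f i ≤ j := by
  by_contra hlt
  have := (lt_conj_iff hf i j).mpr (not_le.mp hlt)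
  omega

lemma psize_add {f g : ℕ → ℕ} (hf : ∃ N, ∀ i, N ≤ i → f i = 0)
    (hg : ∃ N, ∀ i, N ≤ i → g i = 0) : psize (fun i => f i + g i) = psize f + psize g := by
  obtain ⟨N, hN⟩ := hf
  obtain ⟨M, hM⟩ := hg
  have hN' : ∀ i, max N M ≤ i → f i = 0 := fun i hi => hN i (by omega)
  have hM' : ∀ i, max N M ≤ i → g i = 0 := fun i hi => hM i (by omega)
  rw [psize_eq_sum hN', psize_eq_sum hM', psize_eq_sum (N := max N M), Finset.sum_add_distrib]
  intro i hi
  rw [hN' i hi, hM' i hi]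

lemma psize_mono {f g : ℕ → ℕ} (hg : ∃ N, ∀ i, N ≤ i → g i = 0) (h : ∀ i, f i ≤ g i) :
    psize f ≤ psize g :=
  Set.ncard_le_ncard (fun x hx => lt_of_lt_of_le hx (h x.1)) (cellsOf_finite hg)

lemma psize_consPart {f : ℕ → ℕ} (hf : IsPartition f) (a : ℕ) :
    psize (consPart a f) = a + psize f := by
  obtain ⟨N, hN⟩ := hf.2
  rw [psize_eq_sum hN, psize_eq_sum (N := N + 1), Finset.sum_range_succ', add_comm]
  · simp
  · rintro (_ | i) hi
    · omega
    · exact hN i (by omega)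

lemma IsPartition.consPart {f : ℕ → ℕ} (hf : IsPartition f) {a : ℕ} (h : f 0 ≤ a) :
    IsPartition (consPart a f) := by
  refine ⟨antitone_nat_of_succ_le ?_, ?_⟩
  · rintro (_ | i)
    · exact h
    · exact hf.1 (Nat.le_succ i)
  · obtain ⟨N, hN⟩ := hf.2
    refine ⟨N + 1, ?_⟩
    rintro (_ | i) hi
    · omega
    · exact hN i (by omega)

lemma IsPartition.tail {f : ℕ → ℕ} (hf : IsPartition f) : IsPartition fun i => f (i + 1) :=
  ⟨fun _ _ h => hf.1 (by omega), hf.2.imp fun _ hN i hi => hN (i + 1) (by omega)⟩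

lemma consPart_tail (f : ℕ → ℕ) : consPart (f 0) (fun i => f (i + 1)) = f := by
  funext i
  rcases i with _ | i <;> rfl

lemma conj_consPart {f : ℕ → ℕ} (hf : IsPartition f) {a : ℕ} (h : f 0 ≤ a) :
    conj (consPart a f) = addCol a (conj f) := by
  funext j
  refine eq_of_forall_lt_iff fun i => ?_
  rw [lt_conj_iff (hf.consPart h), addCol]
  have h0 := lt_conj_iff hf 0 j
  rcases i with _ | i
  · rw [consPart_zero]
    split_ifs <;> omega
  · rw [consPart_succ]
    have h1 := lt_conj_iff hf i j
    have h2 := hf.1 (Nat.zero_le i)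
    split_ifs <;> omega

lemma conj_tail {f : ℕ → ℕ} (hf : IsPartition f) (j : ℕ) :
    conj (fun i => f (i + 1)) j = conj f j - 1 := by
  refine eq_of_forall_lt_iff fun i => ?_
  rw [lt_conj_iff hf.tail, ← lt_conj_iff hf]
  omega

/-- Between two nested partitions there are partitions of every intermediate size. -/
lemma exists_partition_between {lo hi : ℕ → ℕ} (hlo : IsPartition lo) (hhi : IsPartition hi)
    (hle : ∀ i, lo i ≤ hi i) {m : ℕ} (h1 : psize lo ≤ m) (h2 : m ≤ psize hi) :
    ∃ μ, IsPartition μ ∧ (∀ i, lo i ≤ μ i) ∧ (∀ i, μ i ≤ hi i) ∧ psize μ = m := by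
  obtain ⟨d, rfl⟩ := Nat.exists_eq_add_of_le h1
  clear h1
  induction d generalizing lo with
  | zero => exact ⟨lo, hlo, fun _ => le_rfl, hle, rfl⟩
  | succ d ih =>
    have hex : ∃ i, lo i < hi i := by
      by_contra hno
      push Not at hno
      have := psize_mono hlo.2 hno
      omega
    set i := Nat.find hex with hi_def
    have hi1 : lo i < hi i := Nat.find_spec hex
    have hi2 : ∀ k < i, lo k = hi k := fun k hk =>
      le_antisymm (hle k) (not_lt.mp (Nat.find_min hex hk))
    set e : ℕ → ℕ := fun k => if k = i then 1 else 0 with he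
    have hezero : ∀ k, i + 1 ≤ k → e k = 0 := fun k hk => by
      simp only [he]
      rw [if_neg (by omega)]
    have hepsize : psize e = 1 := by
      rw [psize_eq_sum hezero]
      simp [he]
    have hsize : psize (fun k => lo k + e k) = psize lo + 1 := by
      rw [psize_add hlo.2 ⟨_, hezero⟩, hepsize]
    have hpart : IsPartition fun k => lo k + e k := by
      refine ⟨fun x y hxy => ?_, ?_⟩
      · have h3 := hlo.1 hxy
        have h4 := hhi.1 hxy
        have h5 := hi2 x
        simp only [he]
        split_ifs with h6 h7 h7
        · omega
        · subst h6
          omega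
        · omega
        · omega
      · obtain ⟨N, hN⟩ := hlo.2
        refine ⟨max N (i + 1), fun k hk => ?_⟩
        simp only [hN k (by omega), hezero k (by omega)]
    obtain ⟨μ, hμ, h3, h4, h5⟩ := ih hpart (fun k => by
        have := hle k
        simp only [he]
        split_ifs with h6
        · subst h6
          omega
        · omega) (by rw [hsize]; omega)
    exact ⟨μ, hμ, fun k => (Nat.le_add_right _ _).trans (h3 k), h4, by rw [h5, hsize]; omega⟩

lemma IsPartition.min_const {f : ℕ → ℕ} (hf : IsPartition f) (x : ℕ) :
    IsPartition fun i => min (f i) x :=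
  ⟨fun _ _ h => min_le_min_right x (hf.1 h), hf.2.imp fun _ hN i hi => by simp [hN i hi]⟩

lemma IsPartition.sub_const {f : ℕ → ℕ} (hf : IsPartition f) (x : ℕ) :
    IsPartition fun i => f i - x :=
  ⟨fun _ _ h => Nat.sub_le_sub_right (hf.1 h) x, hf.2.imp fun _ hN i hi => by simp [hN i hi]⟩

lemma IsPartition.max {f g : ℕ → ℕ} (hf : IsPartition f) (hg : IsPartition g) :
    IsPartition fun i => max (f i) (g i) := by
  refine ⟨fun _ _ h => max_le_max (hf.1 h) (hg.1 h), ?_⟩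
  obtain ⟨N, hN⟩ := hf.2
  obtain ⟨M, hM⟩ := hg.2
  exact ⟨N + M, fun i hi => by simp [hN i (by omega), hM i (by omega)]⟩

lemma psize_min_add_sub {f : ℕ → ℕ} (hf : IsPartition f) (x : ℕ) :
    psize (fun i => min (f i) x) + psize (fun i => f i - x) = psize f := by
  rw [← psize_add (hf.min_const x).2 (hf.sub_const x).2]
  congr 1
  funext i
  omega

/-- A partition with parts at most `2x` contains a partition of half its size such that all rows
of the subpartition and of the complement have length at most `x`. -/
lemma exists_half {κ : ℕ → ℕ} (hκ : IsPartition κ) {x m : ℕ} (h0 : κ 0 ≤ 2 * x)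
    (h1 : 2 * m ≤ psize κ) (h2 : psize κ ≤ 2 * m + 1) :
    ∃ μ, IsPartition μ ∧ (∀ i, μ i ≤ κ i) ∧ psize μ = m ∧ (∀ i, μ i ≤ x) ∧
      ∀ i, κ i - μ i ≤ x := by
  have hle : ∀ i, κ i ≤ 2 * x := fun i => (hκ.1 (Nat.zero_le i)).trans h0
  have hlohi : ∀ i, κ i - x ≤ min (κ i) x := fun i => by
    have := hle i
    omega
  have hsum := psize_min_add_sub hκ x
  have hmono := psize_mono (hκ.min_const x).2 hlohi
  obtain ⟨μ, hμ, h3, h4, h5⟩ := exists_partition_between (hκ.sub_const x) (hκ.min_const x) hlohi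
    (m := m) (by omega) (by omega)
  exact ⟨μ, hμ, fun i => (h4 i).trans (min_le_left _ _), h5,
    fun i => (h4 i).trans (min_le_right _ _), fun i => by have := h3 i; omega⟩

/-! ### Positivity for a pair of partitions and for their conjugates -/

/-- The rows of `l / m`, sorted into a partition. -/
noncomputable def sortedRows (l m : ℕ → ℕ) : ℕ → ℕ := conj (conj fun i => l i - m i)

lemma sub_eventually_zero {l : ℕ → ℕ} (hl : IsPartition l) (m : ℕ → ℕ) :
    ∃ N, ∀ i, N ≤ i → l i - m i = 0 :=
  hl.2.imp fun N hN i hi => by simp [hN i hi]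

lemma isPartition_sortedRows {l : ℕ → ℕ} (hl : IsPartition l) (m : ℕ → ℕ) :
    IsPartition (sortedRows l m) :=
  (isPartition_conj (sub_eventually_zero hl m)).conj

lemma conj_sortedRows {l : ℕ → ℕ} (hl : IsPartition l) (m : ℕ → ℕ) (j : ℕ) :
    conj (sortedRows l m) j = conj (fun i => l i - m i) j := by
  rw [sortedRows, conj_conj (isPartition_conj (sub_eventually_zero hl m))]

lemma lt_sortedRows_zero_iff {l : ℕ → ℕ} (hl : IsPartition l) (m : ℕ → ℕ) (x : ℕ) :
    x < sortedRows l m 0 ↔ ∃ i, x < l i - m i := by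
  rw [sortedRows, lt_conj_iff (isPartition_conj (sub_eventually_zero hl m)), SylowBranching.conj,
    Set.ncard_pos (finite_setOf_lt (sub_eventually_zero hl m) x)]
  rfl

lemma sortedRows_zero_le {l : ℕ → ℕ} (hl : IsPartition l) (m : ℕ → ℕ) {x : ℕ}
    (h : ∀ i, l i - m i ≤ x) : sortedRows l m 0 ≤ x := by
  by_contra hlt
  obtain ⟨i, hi⟩ := (lt_sortedRows_zero_iff hl m x).mp (not_le.mp hlt)
  have := h i
  omega

lemma le_sortedRows_zero {l : ℕ → ℕ} (hl : IsPartition l) (m : ℕ → ℕ) (i : ℕ) :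
    l i - m i ≤ sortedRows l m 0 := by
  by_contra hlt
  have := (lt_sortedRows_zero_iff hl m (sortedRows l m 0)).mpr ⟨i, not_le.mp hlt⟩
  omega

/-- Positivity of the Littlewood–Richardson coefficient for `l, m, ν` and for their conjugates. -/
def BiPos (l m ν : ℕ → ℕ) : Prop := LRPos l m ν ∧ LRPos (conj l) (conj m) (conj ν)

section BiPos

variable {l m ν : ℕ → ℕ}

lemma BiPos.conj (h : BiPos l m ν) (hl : IsPartition l) (hm : IsPartition m)
    (hν : IsPartition ν) : BiPos (conj l) (conj m) (conj ν) := by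
  refine ⟨h.2, ?_⟩
  rw [conj_conj hl, conj_conj hm, conj_conj hν]
  exact h.1

lemma biPos_sortedRows (hl : IsPartition l) (hm : IsPartition m) (hml : ∀ i, m i ≤ l i) :
    BiPos l m (sortedRows l m) := by
  refine ⟨lrPos_rowFill hl hml, ?_⟩
  have hle : ∀ j, SylowBranching.conj m j ≤ SylowBranching.conj l j := by
    intro j
    by_contra hlt
    have h1 := (lt_conj_iff hm _ _).mp (not_le.mp hlt)
    have h2 := lt_conj_iff hl (SylowBranching.conj l j) j
    have := hml (SylowBranching.conj l j)
    omega
  have h := lrPos_colFill hl.conj hm.conj hle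
  rw [conj_conj hl, conj_conj hm] at h
  rwa [sortedRows, conj_conj (isPartition_conj (sub_eventually_zero hl m))]

lemma BiPos.psize_eq (h : BiPos l m ν) (hl : IsPartition l) (hm : IsPartition m)
    (hν : IsPartition ν) : psize l = psize m + psize ν := by
  obtain ⟨⟨hml, T, hT⟩, -⟩ := h
  exact (hT.isLRFilling (skewCells_finite hl m)).psize_eq hl hm hν hml

lemma BiPos.consPart (h : BiPos l m ν) (hl : IsPartition l) (hm : IsPartition m)
    (hν : IsPartition ν) {a b : ℕ} (ha : m 0 ≤ a) (hb : ν 0 ≤ b) :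
    l 0 ≤ a + b ∧ BiPos (consPart (a + b) l) (consPart a m) (consPart b ν) := by
  have hab : l 0 ≤ a + b := by
    obtain ⟨⟨hml, T, hT⟩, -⟩ := h
    have := (hT.isLRFilling (skewCells_finite hl m)).first_part_le hl
    omega
  refine ⟨hab, h.1.consPart hl hb, ?_⟩
  rw [conj_consPart hl hab, conj_consPart hm ha, conj_consPart hν hb]
  refine h.2.addCol hl.conj ?_ ?_ <;> intro i hi
  · refine Nat.le_zero.mp (hm.conj.le_of_conj_le ?_)
    rw [conj_conj hm]
    omega
  · refine Nat.le_zero.mp (hl.conj.le_of_conj_le ?_)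
    rw [conj_conj hl]
    omega

end BiPos

/-! ### Partitions with two rows -/

/-- The partition `(a, b)`. -/
def twoRow (a b : ℕ) : ℕ → ℕ := fun i => if i = 0 then a else if i = 1 then b else 0

/-- The partition with columns of lengths `a` and `b`. -/
def twoCol (a b : ℕ) : ℕ → ℕ := fun i => (if i < a then 1 else 0) + if i < b then 1 else 0

lemma isPartition_twoRow {a b : ℕ} (h : b ≤ a) : IsPartition (twoRow a b) := by
  refine ⟨fun i j hij => ?_, 2, fun i hi => ?_⟩ <;> simp only [twoRow] <;> split_ifs <;> omega

lemma psize_twoRow (a b : ℕ) : psize (twoRow a b) = a + b := by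
  rw [psize_eq_sum (N := 2)]
  · simp [Finset.sum_range_succ, twoRow]
  · intro i hi
    simp only [twoRow]
    split_ifs <;> omega

lemma conj_twoRow {a b : ℕ} (h : b ≤ a) : conj (twoRow a b) = twoCol a b := by
  funext j
  refine eq_of_forall_lt_iff fun i => ?_
  rw [lt_conj_iff (isPartition_twoRow h)]
  simp only [twoRow, twoCol]
  split_ifs <;> omega

lemma lrPos_twoRow (s k : ℕ) (hk : k ≤ 3) :
    LRPos (twoRow (2 * s + 6 - k) (2 * s + k)) (twoRow (s + 3) s) (twoRow (s + 3) s) := by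
  set γ := skewCells (twoRow (2 * s + 6 - k) (2 * s + k)) (twoRow (s + 3) s) with hγ
  have hmem : ∀ i x, (i, x) ∈ γ ↔ (i = 0 ∧ s + 3 ≤ x ∧ x < 2 * s + 6 - k) ∨
      (i = 1 ∧ s ≤ x ∧ x < 2 * s + k) := by
    intro i x
    simp only [hγ, skewCells, twoRow, Set.mem_ofPred_eq]
    split_ifs <;> omega
  have h1 : {c ∈ γ | (if c.1 = 0 ∨ c.2 < s + k then 1 else 2) = 1} =
      (fun x => (0, x)) '' Set.Ico (s + 3) (2 * s + 6 - k) ∪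
        (fun x => (1, x)) '' Set.Ico s (s + k) := by
    ext ⟨i, x⟩
    simp only [Set.mem_ofPred_eq, hmem, Set.mem_union, Set.mem_image, Set.mem_Ico, Prod.mk.injEq]
    constructor
    · rintro ⟨h, h'⟩
      have h2 : i = 0 ∨ x < s + k := by
        by_contra h2
        rw [if_neg h2] at h'
        omega
      rcases h with h | h
      · exact Or.inl ⟨x, by omega, by omega, rfl⟩
      · exact Or.inr ⟨x, by omega, by omega, rfl⟩
    · rintro (⟨y, hy, rfl, rfl⟩ | ⟨y, hy, rfl, rfl⟩)
      · exact ⟨by omega, by simp⟩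
      · exact ⟨by omega, by simp [hy.2]⟩
  have h2 : {c ∈ γ | (if c.1 = 0 ∨ c.2 < s + k then 1 else 2) = 2} =
      (fun x => (1, x)) '' Set.Ico (s + k) (2 * s + k) := by
    ext ⟨i, x⟩
    simp only [Set.mem_ofPred_eq, hmem, Set.mem_image, Set.mem_Ico, Prod.mk.injEq]
    constructor
    · rintro ⟨h, h'⟩
      have h2 : ¬ (i = 0 ∨ x < s + k) := by
        intro h2
        rw [if_pos h2] at h'
        omega
      exact ⟨x, by omega, by omega, rfl⟩
    · rintro ⟨y, hy, rfl, rfl⟩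
      exact ⟨by omega, by rw [if_neg]; omega⟩
  refine ⟨fun i => ?_, fun c => if c.1 = 0 ∨ c.2 < s + k then 1 else 2, ?_, ?_, ?_, ?_, ?_⟩
  · simp only [twoRow]
    split_ifs <;> omega
  · intro c _
    split_ifs <;> omega
  · rintro (_ | _ | j)
    · rw [h1, Set.ncard_union_eq, Set.ncard_image_of_injective _ (Prod.mk_right_injective 0),
        Set.ncard_image_of_injective _ (Prod.mk_right_injective 1),
        Set.ncard_eq_toFinset_card', Set.ncard_eq_toFinset_card']
      · simp [twoRow]
        omega
      · rw [Set.disjoint_left]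
        rintro _ ⟨x, _, rfl⟩ ⟨y, _, h⟩
        simp at h
    · rw [h2, Set.ncard_image_of_injective _ (Prod.mk_right_injective 1),
        Set.ncard_eq_toFinset_card']
      simp [twoRow]
      omega
    · convert Set.ncard_empty (ℕ × ℕ)
      swap
      · simp [twoRow]
      rw [Set.eq_empty_iff_forall_notMem]
      rintro c ⟨_, h⟩
      split_ifs at h <;> omega
  · intro i x x' h h' hx
    dsimp only
    split_ifs <;> omega
  · intro i i' x h h' hi
    rw [hmem] at h h'
    dsimp only
    rw [if_pos (by omega), if_neg (by omega)]
    omega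
  · intro j hj
    refine ⟨fun c => (0, c.2 + 3 - k), ?_, ?_⟩
    · rintro ⟨i, x⟩ ⟨h, h'⟩ ⟨i', x'⟩ ⟨h3, h3'⟩ heq
      rw [hmem] at h h3
      simp only [Prod.mk.injEq, true_and] at heq ⊢
      dsimp only at h' h3'
      split_ifs at h' h3' <;> omega
    · rintro ⟨i, x⟩ h h'
      rw [hmem] at h ⊢
      dsimp only at h' ⊢
      split_ifs at h' with h3
      · omega
      · simp only [true_or, if_true, true_and]
        omega

lemma lrPos_twoCol (s k : ℕ) (hk : k ≤ 3) :
    LRPos (twoCol (2 * s + 6 - k) (2 * s + k)) (twoCol (s + 3) s) (twoCol (s + 3) s) := by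
  set γ := skewCells (twoCol (2 * s + 6 - k) (2 * s + k)) (twoCol (s + 3) s) with hγ
  have hmem : ∀ i x, (i, x) ∈ γ ↔ (x = 0 ∧ s + 3 ≤ i ∧ i < 2 * s + 6 - k) ∨
      (x = 1 ∧ s ≤ i ∧ i < 2 * s + k) := by
    intro i x
    simp only [hγ, skewCells, twoCol, Set.mem_ofPred_eq]
    split_ifs <;> omega
  set T : ℕ × ℕ → ℕ := fun c => if c.2 = 1 then c.1 - s + 1 else
    if c.1 < 2 * s + 3 then c.1 - (s + 3) + 1 else c.1 - (s + 3) + 1 + k with hT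
  have hT0 : ∀ i x, (x ≠ 1 ∧ i < 2 * s + 3 ∧ T (i, x) = i - (s + 3) + 1) ∨
      (x ≠ 1 ∧ 2 * s + 3 ≤ i ∧ T (i, x) = i - (s + 3) + 1 + k) ∨
      (x = 1 ∧ T (i, x) = i - s + 1) := by
    intro i x
    simp only [hT]
    split_ifs <;> omega
  refine ⟨fun i => ?_, T, ?_, ?_, ?_, ?_, ?_⟩
  · simp only [twoCol]
    split_ifs <;> omega
  · rintro ⟨i, x⟩ _
    have := hT0 i x
    omega
  · intro j
    have hset : {c ∈ γ | T c = j + 1} =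
        (if j < s + k then {(s + j, 1)} else ∅) ∪
        (if j < s then {(s + 3 + j, 0)} else
          if s + k ≤ j ∧ j < s + 3 then {(s + 3 + j - k, 0)} else ∅) := by
      ext ⟨i, x⟩
      simp only [Set.mem_ofPred_eq, hmem, Set.mem_union]
      have := hT0 i x
      split_ifs <;> simp <;> omega
    rw [hset, Set.ncard_union_eq ?_ ?_ ?_]
    · simp only [twoCol]
      split_ifs <;> simp <;> omega
    · split_ifs <;> simp
    · split_ifs <;> simp
    · split_ifs <;> simp
  · intro i x x' h h' hx
    rw [hmem] at h h'
    have := hT0 i x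
    have := hT0 i x'
    omega
  · intro i i' x h h' hi
    rw [hmem] at h h'
    have := hT0 i x
    have := hT0 i' x
    omega
  · intro j hj
    set φ : ℕ × ℕ → ℕ × ℕ := fun c => if c.1 = 2 * s + 3 ∧ c.2 = 0 then (2 * s + k - 1, 1) else
      (c.1 - 1, c.2) with hφ
    have hφ0 : ∀ i x, (i = 2 * s + 3 ∧ x = 0 ∧ φ (i, x) = (2 * s + k - 1, 1)) ∨
        (¬ (i = 2 * s + 3 ∧ x = 0) ∧ φ (i, x) = (i - 1, x)) := by
      intro i x
      simp only [hφ]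
      split_ifs with h
      · exact Or.inl ⟨h.1, h.2, rfl⟩
      · exact Or.inr ⟨h, rfl⟩
    refine ⟨φ, ?_, ?_⟩
    · rintro ⟨i, x⟩ ⟨h, h'⟩ ⟨i', x'⟩ ⟨h3, h3'⟩ heq
      rw [hmem] at h h3
      have h4 := hT0 i x
      have h5 := hT0 i' x'
      rcases hφ0 i x with ⟨_, _, h6⟩ | ⟨_, h6⟩ <;> rcases hφ0 i' x' with ⟨_, _, h7⟩ | ⟨_, h7⟩ <;>
        rw [h6, h7] at heq <;> simp only [Prod.mk.injEq] at heq ⊢ <;> omega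
    · rintro ⟨i, x⟩ h h'
      rw [hmem] at h
      have h4 := hT0 i x
      rcases hφ0 i x with ⟨_, _, h6⟩ | ⟨_, h6⟩ <;> rw [h6, hmem]
      · have := hT0 (2 * s + k - 1) 1
        dsimp only
        omega
      · have := hT0 (i - 1) x
        dsimp only
        omega

lemma biPos_twoRow (s k : ℕ) (hk : k ≤ 3) :
    BiPos (twoRow (2 * s + 6 - k) (2 * s + k)) (twoRow (s + 3) s) (twoRow (s + 3) s) := by
  refine ⟨lrPos_twoRow s k hk, ?_⟩
  rw [conj_twoRow (by omega), conj_twoRow (by omega)]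
  exact lrPos_twoCol s k hk

/-! ### Splitting a partition into two allowed halves -/

/-- The pair (largest part, number of parts) fits in the `t × t` box and differs from those of
`(t - 1, t - 2)`, its conjugate and the hook `(t - 1, 1 ^ (t - 2))`. -/
def Allowed (t x y : ℕ) : Prop :=
  x ≤ t ∧ y ≤ t ∧ ¬ (x + 1 = t ∧ y = 2) ∧ ¬ (x = 2 ∧ y + 1 = t) ∧ ¬ (x + 1 = t ∧ y + 1 = t)

/-- `l` occurs in a product of two allowed partitions of `2 * t - 3`, compatibly with
conjugation. -/
def Splits (t : ℕ) (l : ℕ → ℕ) : Prop :=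
  ∃ m ν, IsPartition m ∧ IsPartition ν ∧ BiPos l m ν ∧ psize m + 3 = 2 * t ∧
    psize ν + 3 = 2 * t ∧ Allowed t (m 0) (conj m 0) ∧ Allowed t (ν 0) (conj ν 0)

lemma Allowed.symm {t x y : ℕ} (h : Allowed t x y) : Allowed t y x := by
  unfold Allowed at *
  omega

lemma Splits.of_conj {t : ℕ} {l : ℕ → ℕ} (hl : IsPartition l) (h : Splits t (conj l)) :
    Splits t l := by
  obtain ⟨m, ν, hm, hν, hb, h1, h2, h3, h4⟩ := h
  refine ⟨conj m, conj ν, hm.conj, hν.conj, ?_, ?_, ?_, ?_, ?_⟩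
  · have := hb.conj hl.conj hm hν
    rwa [conj_conj hl] at this
  · rwa [psize_conj hm]
  · rwa [psize_conj hν]
  · rw [conj_conj hm]
    exact h3.symm
  · rw [conj_conj hν]
    exact h4.symm

lemma sum_range_le_psize {f : ℕ → ℕ} (hf : IsPartition f) (k : ℕ) :
    ∑ i ∈ Finset.range k, f i ≤ psize f := by
  obtain ⟨N, hN⟩ := hf.2
  rw [psize_eq_sum (N := N + k) fun i hi => hN i (by omega)]
  exact Finset.sum_le_sum_of_subset (Finset.range_mono (by omega))

lemma first_add_second_le_psize {f : ℕ → ℕ} (hf : IsPartition f) : f 0 + f 1 ≤ psize f := by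
  have := sum_range_le_psize hf 2
  simpa [Finset.sum_range_succ] using this

lemma conj_zero_le_psize {f : ℕ → ℕ} (hf : IsPartition f) : conj f 0 ≤ psize f := by
  have := first_add_second_le_psize hf.conj
  rw [psize_conj hf] at this
  omega

lemma conj_mono {f g : ℕ → ℕ} (hg : IsPartition g) (h : ∀ i, f i ≤ g i) (j : ℕ) :
    conj f j ≤ conj g j :=
  Set.ncard_le_ncard (fun i hi => lt_of_lt_of_le hi (h i)) (finite_setOf_lt hg.2 j)

lemma conj_consPart_zero {f : ℕ → ℕ} (hf : IsPartition f) {a : ℕ} (h : f 0 ≤ a) (ha : 0 < a) :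
    conj (consPart a f) 0 = conj f 0 + 1 := by
  rw [conj_consPart hf h, addCol, if_pos ha, add_comm]

section splits

variable {t C a b : ℕ} {l m : ℕ → ℕ}

lemma splits_of_rows (hl : IsPartition l) (hm : IsPartition m) (hml : ∀ i, m i ≤ l i)
    (hsize : psize l + 6 = 4 * t) (hsm : psize m + 3 = 2 * t) (h1 : Allowed t (m 0) (conj m 0))
    (h2 : Allowed t (sortedRows l m 0) (conj (sortedRows l m) 0)) : Splits t l := by
  have hb := biPos_sortedRows hl hm hml
  have := hb.psize_eq hl hm (isPartition_sortedRows hl m)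
  exact ⟨m, _, hm, isPartition_sortedRows hl m, hb, hsm, by omega, h1, h2⟩

lemma splits_consPart {ν : ℕ → ℕ} (hb : BiPos l m ν) (hl : IsPartition l) (hm : IsPartition m)
    (hν : IsPartition ν) (hC : C = a + b) (ha : m 0 ≤ a) (hb' : ν 0 ≤ b) (ha0 : 0 < a)
    (hb0 : 0 < b) (hsize : psize l + C + 6 = 4 * t) (hsm : psize m + a + 3 = 2 * t)
    (h1 : Allowed t a (conj m 0 + 1)) (h2 : Allowed t b (conj ν 0 + 1)) :
    Splits t (consPart C l) := by
  subst hC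
  have := hb.psize_eq hl hm hν
  refine ⟨consPart a m, consPart b ν, hm.consPart ha, hν.consPart hb',
    (hb.consPart hl hm hν ha hb').2, ?_, ?_, ?_, ?_⟩
  · rw [psize_consPart hm]
    omega
  · rw [psize_consPart hν]
    omega
  · rwa [conj_consPart_zero hm ha ha0]
  · rwa [conj_consPart_zero hν hb' hb0]

lemma splits_consPart_rows (hl : IsPartition l) (hm : IsPartition m) (hml : ∀ i, m i ≤ l i)
    (hC : C = a + b) (ha : m 0 ≤ a) (hb : ∀ i, l i - m i ≤ b) (ha0 : 0 < a) (hb0 : 0 < b)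
    (hsize : psize l + C + 6 = 4 * t) (hsm : psize m + a + 3 = 2 * t)
    (h1 : Allowed t a (conj m 0 + 1)) (h2 : Allowed t b (conj (sortedRows l m) 0 + 1)) :
    Splits t (consPart C l) :=
  splits_consPart (biPos_sortedRows hl hm hml) hl hm (isPartition_sortedRows hl m) hC ha
    (sortedRows_zero_le hl m hb) ha0 hb0 hsize hsm h1 h2

lemma splits_consPart_cols (hl : IsPartition l) (hm : IsPartition m) (hml : ∀ i, m i ≤ conj l i)
    (hC : C = a + b) (ha : conj m 0 ≤ a) (hb : conj (fun j => conj l j - m j) 0 ≤ b) (ha0 : 0 < a)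
    (hb0 : 0 < b) (hsize : psize l + C + 6 = 4 * t) (hsm : psize m + a + 3 = 2 * t)
    (h1 : Allowed t a (m 0 + 1)) (h2 : Allowed t b (sortedRows (conj l) m 0 + 1)) :
    Splits t (consPart C l) := by
  have hν := isPartition_sortedRows hl.conj m
  have hbi := (biPos_sortedRows hl.conj hm hml).conj hl.conj hm hν
  rw [conj_conj hl] at hbi
  refine splits_consPart hbi hl hm.conj hν.conj hC ha ?_ ha0 hb0 hsize ?_ ?_ ?_
  · rwa [conj_sortedRows hl.conj]
  · rwa [psize_conj hm]
  · rwa [conj_conj hm]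
  · rwa [conj_conj hν]

lemma psize_sortedRows (hl : IsPartition l) (hm : IsPartition m) (hml : ∀ i, m i ≤ l i) :
    psize m + psize (sortedRows l m) = psize l :=
  ((biPos_sortedRows hl hm hml).psize_eq hl hm (isPartition_sortedRows hl m)).symm

lemma splits_twoRow {k : ℕ} (ht : 5 ≤ t) (hk : k ≤ 3) (hl : IsPartition l) (h0 : l 0 + k = 2 * t)
    (h1 : l 1 + 6 = 2 * t + k) (h2 : l 2 = 0) : Splits t l := by
  obtain ⟨s, rfl⟩ := Nat.exists_eq_add_of_le' (show 3 ≤ t by omega)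
  have heq : l = twoRow (2 * s + 6 - k) (2 * s + k) := by
    funext i
    rcases i with _ | _ | i
    · simp only [twoRow, if_true]
      omega
    · simp only [twoRow]
      norm_num
      omega
    · have := hl.1 (show 2 ≤ i + 1 + 1 by omega)
      simp only [twoRow]
      norm_num
      omega
  have hp := isPartition_twoRow (Nat.le_add_right s 3)
  have hall : Allowed (s + 3) (twoRow (s + 3) s 0) (conj (twoRow (s + 3) s) 0) := by
    rw [conj_twoRow (by omega)]
    simp only [twoRow, twoCol, if_true, Allowed]
    split_ifs <;> omega
  have hsize : psize (twoRow (s + 3) s) + 3 = 2 * (s + 3) := by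
    rw [psize_twoRow]
    omega
  rw [heq]
  exact ⟨_, _, hp, hp, biPos_twoRow s k hk, hsize, hsize, hall, hall⟩

lemma isPartition_zero : IsPartition fun _ => 0 := ⟨fun _ _ _ => le_rfl, 0, fun _ _ => rfl⟩

lemma psize_zero : psize (fun _ => 0) = 0 := by
  simp [psize_eq_sum (f := fun _ => 0) (N := 0) fun _ _ => rfl]

lemma splits_of_first_eq_two_mul (ht : 5 ≤ t) (hl : IsPartition l)
    (hsize : psize l + 2 * t + 6 = 4 * t) : Splits t (consPart (2 * t) l) := by
  obtain ⟨m, hm, -, hml, hsm⟩ := exists_partition_between isPartition_zero hl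
    (fun _ => Nat.zero_le _) (m := t - 3) (by rw [psize_zero]; omega) (by omega)
  have h1 := first_add_second_le_psize hm
  have h2 := conj_zero_le_psize hm
  have hν := isPartition_sortedRows hl m
  have h3 := first_add_second_le_psize hν
  have h4 := conj_zero_le_psize hν
  have h5 := psize_sortedRows hl hm hml
  have h6 := le_sortedRows_zero hl m
  refine splits_consPart_rows hl hm hml (a := t) (b := t) (by omega) (by omega)
    (fun i => by have := h6 i; omega) (by omega) (by omega) (by omega) (by omega) ?_ ?_ <;>
    unfold Allowed <;> omega

lemma psize_sub_const_le {x : ℕ} (hl : IsPartition l) (h : l 1 ≤ x) :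
    psize (fun i => l i - x) = l 0 - x := by
  rw [psize_eq_sum (N := 1)]
  · simp
  · intro i hi
    have := hl.1 hi
    omega

lemma splits_of_first_eq_two_mul_sub_two (ht : 5 ≤ t) (hl : IsPartition l)
    (hsize : psize l + C + 6 = 4 * t) (hC : C + 2 = 2 * t) (h0 : l 0 ≤ C) :
    Splits t (consPart C l) := by
  have h01 := first_add_second_le_psize hl
  have hanti := hl.1 (Nat.zero_le 1)
  by_cases hrow : l 0 + 4 = 2 * t
  · refine splits_twoRow (k := 2) ht (by omega) (hl.consPart h0) ?_ ?_ ?_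
    · rw [consPart_zero]
      omega
    · rw [consPart_succ]
      omega
    · rw [consPart_succ]
      omega
  obtain ⟨m, hm, hlo, hml, hsm⟩ := exists_partition_between (hl.sub_const (t - 2)) hl
    (fun _ => Nat.sub_le _ _) (m := t - 3) (by
      rw [psize_sub_const_le hl (by omega)]
      omega) (by omega)
  have h1 := first_add_second_le_psize hm
  have h2 := conj_zero_le_psize hm
  have hν := isPartition_sortedRows hl m
  have h3 := conj_zero_le_psize hν
  have h5 := psize_sortedRows hl hm hml
  refine splits_consPart_rows hl hm hml (a := t) (b := t - 2) (by omega) (by omega)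
    (fun i => by have := hlo i; omega) (by omega) (by omega) (by omega) (by omega) ?_ ?_ <;>
    unfold Allowed <;> omega

end splits

lemma psize_eq_first_add_tail {f : ℕ → ℕ} (hf : IsPartition f) :
    psize f = f 0 + psize fun i => f (i + 1) := by
  conv_lhs => rw [← consPart_tail f]
  exact psize_consPart hf.tail _

lemma psize_le_mul {f : ℕ → ℕ} (hf : IsPartition f) : psize f ≤ conj f 0 * f 0 := by
  rw [psize_eq_sum (N := conj f 0) fun i hi => Nat.le_zero.mp (hf.le_of_conj_le hi)]
  refine (Finset.sum_le_card_nsmul _ _ (f 0) fun i _ => hf.1 (Nat.zero_le i)).trans ?_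
  simp

/-- The first `x` rows and the first `y` columns overlap in at most `x * y` cells. -/
lemma sum_rows_add_sum_cols_le {f : ℕ → ℕ} (hf : IsPartition f) (x y : ℕ) :
    ∑ i ∈ Finset.range x, f i + ∑ j ∈ Finset.range y, conj f j ≤ psize f + x * y := by
  induction x generalizing f with
  | zero =>
    have := sum_range_le_psize hf.conj y
    rw [psize_conj hf] at this
    simpa using this
  | succ x ih =>
    have h1 := ih hf.tail
    have h2 := psize_eq_first_add_tail hf
    have h3 : ∑ j ∈ Finset.range y, conj f j ≤
        ∑ j ∈ Finset.range y, conj (fun i => f (i + 1)) j + y := by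
      have : ∑ j ∈ Finset.range y, (conj (fun i => f (i + 1)) j + 1) =
          ∑ j ∈ Finset.range y, conj (fun i => f (i + 1)) j + y := by
        rw [Finset.sum_add_distrib]
        simp
      rw [← this]
      refine Finset.sum_le_sum fun j _ => ?_
      rw [conj_tail hf]
      omega
    rw [Finset.sum_range_succ', Nat.succ_mul]
    omega

lemma first_add_conj_le {f : ℕ → ℕ} (hf : IsPartition f) : f 0 + conj f 0 ≤ psize f + 1 := by
  simpa using sum_rows_add_sum_cols_le hf 1 1

section splits

variable {t C : ℕ} {l m : ℕ → ℕ}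

lemma splits_of_first_eq_two_mul_sub_four (ht : 5 ≤ t) (hl : IsPartition l)
    (hsize : psize l + C + 6 = 4 * t) (hC : C + 4 = 2 * t) (h0 : l 0 ≤ 1) :
    Splits t (consPart C l) := by
  obtain ⟨m, hm, -, hml, hsm⟩ := exists_partition_between isPartition_zero hl
    (fun _ => Nat.zero_le _) (m := t - 1) (by rw [psize_zero]; omega) (by omega)
  have h1 := hml 0
  have h2 := conj_zero_le_psize hm
  have h4 := conj_zero_le_psize (isPartition_sortedRows hl m)
  have h5 := psize_sortedRows hl hm hml
  refine splits_consPart_rows hl hm hml (a := t - 2) (b := t - 2) (by omega) (by omega)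
    (fun i => by have := hl.1 (Nat.zero_le i); omega) (by omega) (by omega) (by omega)
    (by omega) ?_ ?_ <;>
    unfold Allowed <;> omega

lemma splits_of_first_eq_two_mul_sub_one (ht : 6 ≤ t) (hl : IsPartition l)
    (hsize : psize l + C + 6 = 4 * t) (hC : C + 1 = 2 * t) (h0 : l 0 ≤ C) :
    Splits t (consPart C l) := by
  have h01 := first_add_second_le_psize hl
  have hanti := hl.1 (Nat.zero_le 1)
  have hhook := first_add_conj_le hl
  have hp := hl.consPart h0
  by_cases hrow : l 0 + 5 = 2 * t
  · refine splits_twoRow (k := 1) (by omega) (by omega) hp ?_ ?_ ?_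
    · rw [consPart_zero]
      omega
    · rw [consPart_succ]
      omega
    · rw [consPart_succ]
      omega
  have hmul := psize_le_mul hl
  by_cases hcol : conj l 0 + 5 = 2 * t
  · refine Splits.of_conj hp ?_
    have h1 := conj_consPart_zero hl h0 (by omega)
    have h2 := psize_eq_first_add_tail hp.conj
    rw [psize_conj hp, psize_consPart hl] at h2
    have h3 := lt_conj_iff hp 1 1
    rw [consPart_succ] at h3
    rw [← consPart_tail (conj (consPart C l))]
    refine splits_of_first_eq_two_mul_sub_four (by omega) hp.conj.tail ?_ ?_ ?_
    · omega
    · omega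
    · rw [zero_add]
      omega
  have hconj1 : 2 ≤ conj l 0 := by
    by_contra hlt
    have : conj l 0 * l 0 ≤ 1 * l 0 := Nat.mul_le_mul_right _ (by omega)
    omega
  have hlenle := conj_zero_le_psize hl
  by_cases hlen : 4 ≤ conj l 0
  · set x := min (t - 3) (conj l 0 - 2) with hx
    obtain ⟨m, hm, hml, hsm, hmx, hlx⟩ := exists_half hl.conj (x := x) (m := t - 3) (by omega)
      (by rw [psize_conj hl]; omega) (by rw [psize_conj hl]; omega)
    have h1 := conj_zero_le_psize hm
    have h2 := conj_zero_le_psize (isPartition_sortedRows hl.conj m)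
    have h3 := psize_sortedRows hl.conj hm hml
    rw [psize_conj hl] at h3
    have h4 := sortedRows_zero_le hl.conj m hlx
    have h5 := le_sortedRows_zero hl.conj m 0
    have h6 := hmx 0
    refine splits_consPart_cols hl hm hml (a := t) (b := t - 1) (by omega) (by omega) ?_ (by omega)
      (by omega) (by omega) (by omega) ?_ ?_
    · rw [← conj_sortedRows hl.conj]
      omega
    · unfold Allowed; omega
    · unfold Allowed; omega
  · obtain ⟨m, hm, hml, hsm, hmx, hlx⟩ := exists_half hl (x := t - 3) (m := t - 3) (by omega)
      (by omega) (by omega)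
    have hν := isPartition_sortedRows hl m
    have h1 := conj_zero_le_psize hm
    have h3 := psize_sortedRows hl hm hml
    have h4 := sortedRows_zero_le hl m hlx
    have h5 := hmx 0
    have h6 := psize_le_mul hν
    have h7 : conj (sortedRows l m) 0 ≤ conj l 0 := by
      rw [conj_sortedRows hl]
      exact conj_mono hl (fun i => Nat.sub_le _ _) 0
    have h8 : 2 ≤ conj (sortedRows l m) 0 := by
      by_contra hlt
      have : conj (sortedRows l m) 0 * sortedRows l m 0 ≤ 1 * sortedRows l m 0 :=
        Nat.mul_le_mul_right _ (by omega)
      omega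
    refine splits_consPart_rows hl hm hml (a := t) (b := t - 1) (by omega) (by omega)
      (fun i => by have := hlx i; omega) (by omega) (by omega) (by omega) (by omega) ?_ ?_ <;>
      unfold Allowed <;> omega

lemma splits_of_first_eq_two_mul_sub_three (ht : 6 ≤ t) (hl : IsPartition l)
    (hsize : psize l + C + 6 = 4 * t) (hC : C + 3 = 2 * t) (h0 : l 0 ≤ C) :
    Splits t (consPart C l) := by
  have h01 := first_add_second_le_psize hl
  have h02 := sum_range_le_psize hl 3
  simp only [Finset.sum_range_succ, Finset.range_zero, Finset.sum_empty, zero_add] at h02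
  have hanti := hl.1 (Nat.zero_le 1)
  have hanti2 := hl.1 (show 1 ≤ 2 by omega)
  have hhook := first_add_conj_le hl
  have hmul := psize_le_mul hl
  have hp := hl.consPart h0
  by_cases hrow : l 0 + 3 = 2 * t
  · refine splits_twoRow (k := 3) (by omega) (by omega) hp ?_ ?_ ?_
    · rw [consPart_zero]
      omega
    · rw [consPart_succ]
      omega
    · rw [consPart_succ]
      omega
  have hl1 : 1 ≤ l 1 := by
    by_contra hlt
    have h1 : conj l 0 ≤ 1 := conj_le_of_forall fun i hi => by
      have := hl.1 hi
      omega
    have : conj l 0 * l 0 ≤ 1 * l 0 := Nat.mul_le_mul_right _ h1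
    omega
  by_cases hcol : l 0 ≤ 1
  · refine Splits.of_conj hp ?_
    have h1 := conj_consPart_zero hl h0 (by omega)
    have h2 := psize_eq_first_add_tail hp.conj
    rw [psize_conj hp, psize_consPart hl] at h2
    have h3 : conj l 0 * l 0 ≤ conj l 0 * 1 := Nat.mul_le_mul_left _ hcol
    rw [← consPart_tail (conj (consPart C l))]
    refine splits_of_first_eq_two_mul_sub_two (by omega) hp.conj.tail ?_ ?_ ?_
    · omega
    · omega
    · exact hp.conj.1 (Nat.zero_le 1)
  by_cases hnear : l 0 + 4 = 2 * t
  · have hm : IsPartition (consPart t (twoRow (t - 4) 1)) :=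
      (isPartition_twoRow (by omega)).consPart (by simp [twoRow])
    have hlen : conj (consPart t (twoRow (t - 4) 1)) 0 ≤ 3 :=
      conj_le_of_forall fun i hi => by
        obtain ⟨i, rfl⟩ := Nat.exists_eq_add_of_le' hi
        simp [consPart, twoRow]
    have hν0 : sortedRows (consPart C l) (consPart t (twoRow (t - 4) 1)) 0 = t := by
      refine le_antisymm (sortedRows_zero_le hp _ ?_) ?_
      · rintro (_ | _ | i)
        · simp only [consPart_zero]
          omega
        · simp only [consPart_succ, zero_add, twoRow, if_true]
          omega
        · have := hl.1 (show 1 ≤ i + 1 by omega)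
          rw [consPart_succ]
          omega
      · have := le_sortedRows_zero hp (consPart t (twoRow (t - 4) 1)) 1
        simp only [consPart, twoRow] at this
        norm_num at this
        omega
    have hν1 : conj (sortedRows (consPart C l) (consPart t (twoRow (t - 4) 1))) 0 ≤ 2 := by
      rw [conj_sortedRows hp]
      refine conj_le_of_forall fun i hi => ?_
      obtain ⟨i, rfl⟩ := Nat.exists_eq_add_of_le' hi
      rcases i with _ | i
      · simp only [consPart, twoRow]
        norm_num
        omega
      · have := hl.1 (show 2 ≤ i + 2 by omega)
        simp only [consPart, twoRow]
        norm_num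
        omega
    refine splits_of_rows hp hm ?_ ?_ ?_ ?_ ?_
    · rintro (_ | _ | _ | i)
      · simp only [consPart_zero]
        omega
      · simp only [consPart, twoRow]
        norm_num
        omega
      · simp only [consPart, twoRow]
        norm_num
        omega
      · simp [consPart, twoRow]
    · rw [psize_consPart hl]
      omega
    · rw [psize_consPart (isPartition_twoRow (by omega)), psize_twoRow]
      omega
    · rw [consPart_zero]
      unfold Allowed
      omega
    · rw [hν0]
      unfold Allowed
      omega
  · set lo : ℕ → ℕ := fun i => max (l i - (t - 2)) (twoRow 2 1 i) with hlo
    have hlop : IsPartition lo := (hl.sub_const (t - 2)).max (isPartition_twoRow (by omega))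
    have hlosize : psize lo ≤ t - 2 := by
      rw [psize_eq_sum (N := 2)]
      · simp [Finset.sum_range_succ, hlo, twoRow]
        omega
      · intro i hi
        have := hl.1 hi
        simp only [hlo, twoRow]
        rw [if_neg (by omega), if_neg (by omega)]
        omega
    obtain ⟨m, hm, hlom, hml, hsm⟩ := exists_partition_between hlop hl
      (fun i => by
        rcases i with _ | _ | i <;> simp only [hlo, twoRow] <;> norm_num <;> omega)
      (m := t - 2) hlosize (by omega)
    have h1 := first_add_second_le_psize hm
    have h2 := first_add_conj_le hm
    have h3 := hlom 0
    have h4 := hlom 1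
    simp only [hlo, twoRow] at h3 h4
    norm_num at h3 h4
    have h5 := conj_zero_le_psize (isPartition_sortedRows hl m)
    have h6 := psize_sortedRows hl hm hml
    have h7 := lt_conj_iff hm 1 0
    refine splits_consPart_rows hl hm hml (a := t - 1) (b := t - 2) (by omega) (by omega)
      (fun i => ?_) (by omega) (by omega) (by omega) (by omega) ?_ ?_
    · have := hlom i
      simp only [hlo] at this
      omega
    · unfold Allowed; omega
    · unfold Allowed; omega

end splits

lemma psize_min_one {f : ℕ → ℕ} (hf : IsPartition f) :
    psize (fun i => min (f i) 1) = conj f 0 := by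
  rw [psize_eq_sum (N := conj f 0)]
  · rw [Finset.sum_congr rfl (g := fun _ => 1)]
    · simp
    · intro i hi
      have := (lt_conj_iff hf i 0).mp (Finset.mem_range.mp hi)
      omega
  · intro i hi
    have := hf.le_of_conj_le hi
    omega

lemma psize_sub_const_of_third_le {f : ℕ → ℕ} {x : ℕ} (hf : IsPartition f) (h : f 2 ≤ x) :
    psize (fun i => f i - x) = (f 0 - x) + (f 1 - x) := by
  rw [psize_eq_sum (N := 2)]
  · simp [Finset.sum_range_succ]
  · intro i hi
    have := hf.1 hi
    omega

section splits

variable {t C a b : ℕ} {l m : ℕ → ℕ}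

lemma splits_of_length_le (ht : 6 ≤ t) (hl : IsPartition l) (hsize : psize l + 6 = 4 * t)
    (hlen : conj l 0 ≤ t) (h6 : 6 ≤ l 0) (h0 : l 0 + 4 ≤ 2 * t) : Splits t l := by
  set x := min (t - 2) (l 0 - 3) with hx
  obtain ⟨m, hm, hml, hsm, hmx, hlx⟩ := exists_half hl (x := x) (m := 2 * t - 3) (by omega)
    (by omega) (by omega)
  have h1 := hmx 0
  have h2 := hlx 0
  have h3 := sortedRows_zero_le hl m hlx
  have h4 := le_sortedRows_zero hl m 0
  have h5 := conj_mono hl hml 0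
  have h7 : conj (sortedRows l m) 0 ≤ conj l 0 := by
    rw [conj_sortedRows hl]
    exact conj_mono hl (fun i => Nat.sub_le _ _) 0
  refine splits_of_rows hl hm hml hsize (by omega) ?_ ?_ <;> unfold Allowed <;> omega

lemma splits_of_second_le_half (ht : 6 ≤ t) (hl : IsPartition l)
    (hsize : psize l + C + 6 = 4 * t) (hC : t + 1 ≤ C) (hC' : C + 4 ≤ 2 * t)
    (hlen : conj l 0 + 5 ≤ 2 * t) (h0 : l 0 ≤ C / 2) : Splits t (consPart C l) := by
  obtain ⟨m, hm, hml, hsm, hmx, hlx⟩ := exists_half hl.conj (x := t - 1)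
    (m := 2 * t - 3 - (C - C / 2)) (by omega) (by rw [psize_conj hl]; omega)
    (by rw [psize_conj hl]; omega)
  have h1 := hmx 0
  have h2 := sortedRows_zero_le hl.conj m hlx
  have h3 := conj_mono hl.conj hml 0
  have h4 := conj_mono hl.conj (fun i => Nat.sub_le (conj l i) (m i)) 0
  rw [conj_conj hl] at h3 h4
  refine splits_consPart_cols hl hm hml (a := C - C / 2) (b := C / 2) (by omega) (by omega)
    (by omega) (by omega) (by omega) (by omega) (by omega) ?_ ?_ <;> unfold Allowed <;> omega

lemma splits_of_second_gt_half (hl : IsPartition l) (hsize : psize l + C + 6 = 4 * t)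
    (hC : C = a + b) (ha3 : 3 ≤ a) (hb3 : 3 ≤ b) (hat : a + 2 ≤ t) (hbt : b + 2 ≤ t)
    (h0 : l 0 ≤ a) (h1 : l 1 ≤ b) (hlen : conj l 0 + 5 ≤ 2 * t) (hcol : conj l 2 + 1 ≤ t)
    (hlo : l 0 + (conj l 0 - t) + (conj l 1 - t) + a + 3 ≤ 2 * t)
    (hhi : C + 3 + (conj l 0 + 1 - t) + (conj l 1 + 1 - t) ≤ 2 * t + a) :
    Splits t (consPart C l) := by
  have hκ := hl.conj
  have hbound : ∀ i, conj l i + 5 ≤ 2 * t := fun i => by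
    have := hκ.1 (Nat.zero_le i)
    omega
  have hlop : IsPartition fun i => min (conj l i) 1 + (conj l i - t) := by
    refine ⟨fun i j hij => add_le_add ((hκ.min_const 1).1 hij) ((hκ.sub_const t).1 hij), ?_⟩
    obtain ⟨N, hN⟩ := hκ.2
    exact ⟨N, fun i hi => by simp [hN i hi]⟩
  have hlosize : psize (fun i => min (conj l i) 1 + (conj l i - t)) =
      l 0 + ((conj l 0 - t) + (conj l 1 - t)) := by
    rw [psize_add (hκ.min_const 1).2 (hκ.sub_const t).2, psize_min_one hκ, conj_conj hl,
      psize_sub_const_of_third_le hκ (by omega)]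
  have hhisize := psize_min_add_sub hκ (t - 1)
  rw [psize_sub_const_of_third_le hκ (by omega), psize_conj hl] at hhisize
  obtain ⟨m, hm, hlom, hmhi, hsm⟩ := exists_partition_between hlop (hκ.min_const (t - 1))
    (fun i => by have := hbound i; omega) (m := 2 * t - 3 - a) (by omega) (by omega)
  have hml : ∀ i, m i ≤ conj l i := fun i => (hmhi i).trans (min_le_left _ _)
  have h2 := conj_mono hκ hml 0
  rw [conj_conj hl] at h2
  have h3 := hmhi 0
  have h4 := sortedRows_zero_le hκ m (x := t - 1) fun i => by
    have := hlom i
    omega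
  refine splits_consPart_cols hl hm hml hC (by omega) ?_ (by omega) (by omega) (by omega)
    (by omega) ?_ ?_
  · refine (conj_le_of_forall fun i hi => ?_).trans h1
    have h5 := lt_conj_iff hl 1 i
    have := hlom i
    omega
  · unfold Allowed
    omega
  · unfold Allowed
    omega

lemma splits_of_long (ht : 15 ≤ t) (hl : IsPartition l) (hsize : psize l + 6 = 4 * t)
    (hC : l 0 ≤ 2 * t) (hC' : 2 * t ≤ l 0 + 3) : Splits t l := by
  have h0 := psize_eq_first_add_tail hl
  have h1 := hl.1 (Nat.zero_le 1)
  rw [← consPart_tail l]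
  obtain h | h | h | h : l 0 = 2 * t ∨ l 0 + 1 = 2 * t ∨ l 0 + 2 = 2 * t ∨ l 0 + 3 = 2 * t := by
    omega
  · rw [h]
    exact splits_of_first_eq_two_mul (by omega) hl.tail (by omega)
  · exact splits_of_first_eq_two_mul_sub_one (by omega) hl.tail (by omega) h h1
  · exact splits_of_first_eq_two_mul_sub_two (by omega) hl.tail (by omega) h h1
  · exact splits_of_first_eq_two_mul_sub_three (by omega) hl.tail (by omega) h h1

lemma splits_of_middle (hl : IsPartition l) (hsize : psize l + 6 = 4 * t) (ht : 15 ≤ t)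
    (hC : t + 1 ≤ l 0) (hC' : l 0 + 4 ≤ 2 * t) (hR : conj l 0 + 4 ≤ 2 * t)
    (h : l 1 ≤ l 0 / 2 ∨ (l 1 + 2 ≤ t ∧ l 1 + l 2 ≤ l 0 ∧ t + 1 ≤ conj l 0 ∧
      l 0 / 2 < l 1 ∧ conj l 0 / 2 < conj l 1 ∧
      2 * l 1 + conj l 0 + (conj l 1 - 1 - t) ≤ 3 * t - 2)) : Splits t l := by
  have hsz := psize_eq_first_add_tail hl
  have hR0 := conj_tail hl 0
  have hR1 := conj_tail hl 1
  have hR2 := conj_tail hl 2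
  have h22 := sum_rows_add_sum_cols_le hl 2 2
  have h32 := sum_rows_add_sum_cols_le hl 3 2
  have h23 := sum_rows_add_sum_cols_le hl 2 3
  have h33 := sum_rows_add_sum_cols_le hl 3 3
  have h03 := sum_rows_add_sum_cols_le hl 0 3
  simp only [Finset.sum_range_succ, Finset.range_zero, Finset.sum_empty, zero_add]
    at h22 h32 h23 h33 h03
  have hl01 := hl.1 (show 0 ≤ 1 by omega)
  have hl12 := hl.1 (show 1 ≤ 2 by omega)
  have hc01 := hl.conj.1 (show 0 ≤ 1 by omega)
  have hc12 := hl.conj.1 (show 1 ≤ 2 by omega)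
  rw [← consPart_tail l]
  rcases h with h | ⟨h1, h2, h3, h4, h5, h6⟩
  · exact splits_of_second_le_half (by omega) hl.tail (by omega) hC hC' (by omega)
      (by rwa [zero_add])
  · obtain ⟨a, ha⟩ : ∃ a, a = max (max (l 1) (l 0 - t + 2))
      (l 0 + conj l 0 + 3 - 3 * t + (conj l 1 - t)) := ⟨_, rfl⟩
    have ha1 : l 1 ≤ a := by omega
    have ha2 : l 0 - t + 2 ≤ a := by omega
    have ha3 : l 0 + conj l 0 + 3 - 3 * t + (conj l 1 - t) ≤ a := by omega
    have ha4 : a + 2 ≤ t := by rw [ha]; clear ha; omega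
    have ha5 : a + l 2 ≤ l 0 := by rw [ha]; clear ha; omega
    have ha6 : l 1 + (conj l 0 - 1 - t) + (conj l 1 - 1 - t) + a + 3 ≤ 2 * t := by
      rw [ha]; clear ha; omega
    have hcol : conj l 2 ≤ t := by omega
    clear ha h22 h32 h23 h33
    refine splits_of_second_gt_half (t := t) (C := l 0) (a := a) (b := l 0 - a) hl.tail (by omega)
      (by omega) (by omega) (by omega) (by omega) (by omega) ?_ ?_ (by omega) (by omega) ?_
      (by omega)
    · rw [zero_add]
      omega
    · rw [one_add_one_eq_two]
      omega
    · rw [hR0, hR1, zero_add]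
      omega

lemma splits_of_box (ht : 15 ≤ t) (hl : IsPartition l) (hsize : psize l + 6 = 4 * t)
    (hC : l 0 ≤ 2 * t) (hR : conj l 0 ≤ 2 * t) : Splits t l := by
  have hcc := conj_conj hl
  have hcsize : psize (conj l) + 6 = 4 * t := by rwa [psize_conj hl]
  by_cases h1 : 2 * t ≤ l 0 + 3
  · exact splits_of_long ht hl hsize hC h1
  by_cases h2 : 2 * t ≤ conj l 0 + 3
  · exact Splits.of_conj hl (splits_of_long ht hl.conj hcsize hR h2)
  by_cases h3 : conj l 0 ≤ t ∧ 6 ≤ l 0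
  · exact splits_of_length_le (by omega) hl hsize h3.1 h3.2 (by omega)
  by_cases h4 : l 0 ≤ t ∧ 6 ≤ conj l 0
  · exact Splits.of_conj hl (splits_of_length_le (by omega) hl.conj hcsize
      (by rw [hcc]; exact h4.1) h4.2 (by omega))
  have hmul := psize_le_mul hl
  have h5 : t + 1 ≤ l 0 ∧ t + 1 ≤ conj l 0 := by
    by_contra hcon
    have hsmall : (l 0 ≤ 5 ∧ conj l 0 ≤ t) ∨ (conj l 0 ≤ 5 ∧ l 0 ≤ t) := by omega
    rcases hsmall with h | h
    · have h6 : conj l 0 ≤ 5 := by omega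
      have := Nat.mul_le_mul h6 h.1
      omega
    · have h6 : l 0 ≤ 5 := by omega
      have := Nat.mul_le_mul h.1 h6
      omega
  have h22 := sum_rows_add_sum_cols_le hl 2 2
  have h32 := sum_rows_add_sum_cols_le hl 3 2
  have h23 := sum_rows_add_sum_cols_le hl 2 3
  have h33 := sum_rows_add_sum_cols_le hl 3 3
  simp only [Finset.sum_range_succ, Finset.range_zero, Finset.sum_empty, zero_add]
    at h22 h32 h23 h33
  by_cases h6 : l 1 ≤ l 0 / 2 ∨ (l 1 + 2 ≤ t ∧ l 1 + l 2 ≤ l 0 ∧ t + 1 ≤ conj l 0 ∧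
      l 0 / 2 < l 1 ∧ conj l 0 / 2 < conj l 1 ∧
      2 * l 1 + conj l 0 + (conj l 1 - 1 - t) ≤ 3 * t - 2)
  · exact splits_of_middle hl hsize ht h5.1 (by omega) (by omega) h6
  · refine Splits.of_conj hl (splits_of_middle hl.conj hcsize ht h5.2 (by omega) ?_ ?_)
    · rw [hcc]
      omega
    · rw [hcc]
      omega

end splits

/-! ### The excluded partitions -/

lemma hookP_apply (a b i : ℕ) :
    hookP a b i = if i = 0 then a else if i ≤ b then 1 else 0 := by
  cases i with
  | zero => simp [hookP, ofList]
  | succ i =>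
    by_cases h : i < b <;> simp [hookP, ofList, List.getD_eq_getElem?_getD, h]

lemma isPartition_hookP {a : ℕ} (ha : 1 ≤ a) (b : ℕ) : IsPartition (hookP a b) := by
  refine ⟨fun i j hij => ?_, b + 1, fun i hi => ?_⟩ <;> simp only [hookP_apply] <;> split_ifs <;>
    omega

lemma conj_hookP_zero {a : ℕ} (ha : 1 ≤ a) (b : ℕ) : conj (hookP a b) 0 = b + 1 := by
  refine eq_of_forall_lt_iff fun i => ?_
  rw [lt_conj_iff (isPartition_hookP ha b), hookP_apply]
  split_ifs <;> omega

lemma ofList_pair (a b : ℕ) : ofList [a, b] = twoRow a b := by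
  funext i
  rcases i with _ | _ | i <;> simp [ofList, twoRow]

lemma not_mem_conjClosure_of_allowed {r : ℕ} (hr : 2 ≤ r) {f : ℕ → ℕ}
    (h : Allowed (r + 1) (f 0) (conj f 0)) :
    f ∉ conjClosure {ofList [r, r - 1], hookP r (r - 1)} := by
  have h2 : IsPartition (twoRow r (r - 1)) := isPartition_twoRow (by omega)
  have hh : IsPartition (hookP r (r - 1)) := isPartition_hookP (by omega) _
  have h20 : conj (twoRow r (r - 1)) 0 = 2 := by
    rw [conj_twoRow (by omega)]
    simp only [twoCol]
    split_ifs <;> omega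
  have hh0 : conj (hookP r (r - 1)) 0 = r := by
    rw [conj_hookP_zero (by omega)]
    omega
  have h2f : twoRow r (r - 1) 0 = r := rfl
  have hhf : hookP r (r - 1) 0 = r := rfl
  rw [ofList_pair]
  rintro ((rfl | rfl) | ⟨g, rfl | rfl, rfl⟩)
  · rw [h20, h2f] at h
    unfold Allowed at h
    omega
  · rw [hh0, hhf] at h
    unfold Allowed at h
    omega
  · rw [conj_conj h2, h20, h2f] at h
    unfold Allowed at h
    omega
  · rw [conj_conj hh, hh0, hhf] at h
    unfold Allowed at h
    omega

/-- for `k ≥ 3` and `r = (3^k + 1)/2`, with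
`B = B_{3^k}(r+1) ∖ {(r, r−1), (r, 1^{r−1})}°`, one has `B ⋆ B = B_{2·3^k}(2r+2)`. -/
theorem star_self_ball (k r : ℕ) (hk : 3 ≤ k) (hr : 2 * r = 3 ^ k + 1) :
    starOp
        (Bset (3 ^ k) (r + 1) \ conjClosure {ofList [r, r - 1], hookP r (r - 1)})
        (Bset (3 ^ k) (r + 1) \ conjClosure {ofList [r, r - 1], hookP r (r - 1)}) =
      Bset (2 * 3 ^ k) (2 * r + 2) := by
  have hpow : 3 ^ 3 ≤ 3 ^ k := Nat.pow_le_pow_right (by norm_num) hk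
  ext l
  constructor
  · rintro ⟨hl, μ, ⟨⟨⟨hμ, hμn⟩, hμ0, hμ1⟩, -⟩, ν, ⟨⟨⟨hν, hνn⟩, hν0, hν1⟩, -⟩, hpos⟩
    obtain ⟨hle, T, hT⟩ := exists_isLRFilling_of_lrCoeff_pos hpos
    have h1 := hT.psize_eq hl hμ hν hle
    have h2 := hT.first_part_le hl
    have h3 := hT.length_le hl hμ hν
    exact ⟨⟨hl, by omega⟩, by omega, by omega⟩
  · rintro ⟨⟨hl, hn⟩, h0, h1⟩
    obtain ⟨μ, ν, hμ, hν, hpos, hμn, hνn, hμa, hνa⟩ :=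
      splits_of_box (t := r + 1) (by omega) hl (by omega) (by omega) (by omega)
    exact ⟨hl, μ, ⟨⟨⟨hμ, by omega⟩, hμa.1, hμa.2.1⟩, not_mem_conjClosure_of_allowed (by omega) hμa⟩,
      ν, ⟨⟨⟨hν, by omega⟩, hνa.1, hνa.2.1⟩, not_mem_conjClosure_of_allowed (by omega) hνa⟩,
      hpos.1.lrCoeff_pos hl hν⟩

end SylowBranching
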